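/- arXiv:1609.01185 — 11 statements merged into one kernel-verified Lean document; each statement's English description precedes it below -/
import Mathlib

section
/- The scale function φ is continuous and strictly increasing on ℝ; moreover, φ is bounded above (equivalently, lim_{x→+∞} φ(x) is finite) if and only if c₊ > 1/2, and φ is bounded below (equivalently, lim_{x→−∞} φ(x) is finite) if and only if c₋ > 1/2. -/
open MeasureTheory intervalIntegral in
/-- Everything except the lower bound. -/
theorem scale_half (atil : ℝ → ℝ) (hatil : MeasureTheory.Integrable atil)
    (cp cm : ℝ) (a : ℝ → ℝ)
    (ha : ∀ x : ℝ, a x = atil x + (if 1 < x then cp else if x < -1 then cm else 0) / x)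
    (φ : ℝ → ℝ)
    (hφ : ∀ x, φ x = ∫ y in (0:ℝ)..x, Real.exp (-2 * ∫ z in (0:ℝ)..y, a z)) :
    Continuous φ ∧ StrictMono φ ∧ (BddAbove (Set.range φ) ↔ 1 / 2 < cp) := by
  set g : ℝ → ℝ := fun x => (if 1 < x then cp else if x < -1 then cm else 0) / x with hg
  have hgm : Measurable g := by
    refine Measurable.div ?_ measurable_id
    exact Measurable.ite measurableSet_Ioi measurable_const
      (Measurable.ite measurableSet_Iio measurable_const measurable_const)
  have hgb : ∀ x, ‖g x‖ ≤ |cp| + |cm| := by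
    intro x
    have h1 := abs_nonneg cp
    have h2 := abs_nonneg cm
    simp only [hg, Real.norm_eq_abs, abs_div]
    split_ifs with h h'
    · have : 1 ≤ |x| := by rw [abs_of_pos] <;> linarith
      exact (div_le_self h1 this).trans (by linarith)
    · have : 1 ≤ |x| := by rw [abs_of_neg] <;> linarith
      exact (div_le_self h2 this).trans (by linarith)
    · simp; linarith
  have hgi : ∀ u v, IntervalIntegrable g volume u v := by
    intro u v
    refine (intervalIntegrable_const (c := |cp| + |cm|)).mono_fun
      hgm.aestronglyMeasurable ?_
    refine Filter.Eventually.of_forall fun x => ?_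
    exact (hgb x).trans (le_abs_self _)
  have hti : ∀ u v, IntervalIntegrable atil volume u v := fun u v => hatil.intervalIntegrable
  have haeq : a = fun x => atil x + g x := funext ha
  have hai : ∀ u v, IntervalIntegrable a volume u v := by
    intro u v; rw [haeq]; exact (hti u v).add (hgi u v)
  set e : ℝ → ℝ := fun y => Real.exp (-2 * ∫ z in (0:ℝ)..y, a z) with he
  have hec : Continuous e :=
    Real.continuous_exp.comp (continuous_const.mul (continuous_primitive hai 0))
  have hei : ∀ u v, IntervalIntegrable e volume u v := fun u v => hec.intervalIntegrable u v
  have hφe : φ = fun x => ∫ y in (0:ℝ)..x, e y := funext hφ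
  have hφd : ∀ x, HasDerivAt φ (e x) x := by
    intro x; rw [hφe]
    exact hec.integral_hasStrictDerivAt 0 x |>.hasDerivAt
  have hmono : StrictMono φ := by
    apply strictMono_of_deriv_pos
    intro x; rw [(hφd x).deriv]; exact Real.exp_pos _
  refine ⟨continuous_iff_continuousAt.2 fun x => (hφd x).continuousAt, hmono, ?_⟩
  set M := ∫ x, ‖atil x‖ with hM
  have htM : ∀ y, |∫ z in (0:ℝ)..y, atil z| ≤ M := by
    intro y
    have h1 := norm_integral_le_integral_norm_uIoc (f := atil) (a := 0) (b := y) (μ := volume)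
    refine h1.trans ?_
    exact setIntegral_le_integral hatil.norm (Filter.Eventually.of_forall fun x => norm_nonneg _)
  have hgint : ∀ y, 1 ≤ y → ∫ z in (0:ℝ)..y, g z = cp * Real.log y := by
    intro y hy
    rw [← integral_add_adjacent_intervals (hgi 0 1) (hgi 1 y)]
    have h1 : ∫ z in (0:ℝ)..1, g z = 0 := by
      rw [intervalIntegral.integral_congr_ae (g := fun _ => (0:ℝ))]
      · simp
      · refine Filter.Eventually.of_forall fun x hx => ?_
        rw [Set.uIoc_of_le zero_le_one] at hx
        have := hx.1
        have := hx.2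
        simp only [hg]
        rw [if_neg (by linarith), if_neg (by linarith), zero_div]
    have h2 : ∫ z in (1:ℝ)..y, g z = ∫ z in (1:ℝ)..y, cp * z⁻¹ := by
      refine intervalIntegral.integral_congr_ae (Filter.Eventually.of_forall fun x hx => ?_)
      rw [Set.uIoc_of_le hy] at hx
      simp only [hg]
      rw [if_pos hx.1, div_eq_mul_inv]
    rw [h1, h2, intervalIntegral.integral_const_mul, integral_inv_of_pos one_pos (by linarith)]
    simp
  have hA : ∀ y, 1 ≤ y → ∫ z in (0:ℝ)..y, a z = (∫ z in (0:ℝ)..y, atil z) + cp * Real.log y := by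
    intro y hy
    rw [← hgint y hy, ← intervalIntegral.integral_add (hti 0 y) (hgi 0 y), haeq]
  have hsplit : ∀ x, φ x = φ 1 + ∫ y in (1:ℝ)..x, e y := by
    intro x
    rw [hφe]
    exact (integral_add_adjacent_intervals (hei 0 1) (hei 1 x)).symm
  constructor
  · rintro ⟨B, hB⟩
    by_contra hcp
    push Not at hcp
    have hlow : ∀ x, 1 ≤ x → φ 1 + Real.exp (-2 * M) * Real.log x ≤ φ x := by
      intro x hx
      rw [hsplit x]
      have h0 : (0:ℝ) ∉ Set.uIcc 1 x := by
        rw [Set.uIcc_of_le hx]; intro h; linarith [h.1]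
      have h1 : Real.exp (-2 * M) * Real.log x = ∫ y in (1:ℝ)..x, Real.exp (-2 * M) * y⁻¹ := by
        rw [intervalIntegral.integral_const_mul, integral_inv h0, div_one]
      rw [h1]
      gcongr
      refine integral_mono_on hx ?_ (hei 1 x) ?_
      · exact (intervalIntegrable_inv_iff.2 (Or.inr h0)).const_mul _
      · intro y hy
        have hy0 : 0 < y := by linarith [hy.1]
        have hl := Real.log_nonneg hy.1
        rw [← Real.exp_log (inv_pos.2 hy0), ← Real.exp_add, Real.log_inv]
        apply Real.exp_le_exp.2
        rw [hA y hy.1]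
        have := (abs_le.1 (htM y)).2
        nlinarith
    set t := |B - φ 1| / Real.exp (-2 * M) + 1 with ht
    have htp : 0 < t := by positivity
    have h1 := hlow (Real.exp t) (Real.one_le_exp htp.le)
    have h2 := hB ⟨Real.exp t, rfl⟩
    rw [Real.log_exp, ht, mul_add, mul_div_cancel₀ _ (Real.exp_pos _).ne'] at h1
    have := le_abs_self (B - φ 1)
    have := Real.exp_pos (-2 * M)
    linarith
  · intro hcp
    refine ⟨φ 1 + Real.exp (2 * M) * (1 / (2 * cp - 1)), ?_⟩
    have key : ∀ x, 1 ≤ x → φ x ≤ φ 1 + Real.exp (2 * M) * (1 / (2 * cp - 1)) := by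
      intro x hx
      rw [hsplit x]
      have h0 : (0:ℝ) ∉ Set.uIcc 1 x := by
        rw [Set.uIcc_of_le hx]; intro h; linarith [h.1]
      have h1 : ∫ y in (1:ℝ)..x, Real.exp (2 * M) * y ^ (-(2 * cp)) ≤
          Real.exp (2 * M) * (1 / (2 * cp - 1)) := by
        rw [intervalIntegral.integral_const_mul,
          integral_rpow (Or.inr ⟨by intro h; linarith, h0⟩), Real.one_rpow]
        refine mul_le_mul_of_nonneg_left ?_ (Real.exp_pos _).le
        have h3 : 0 ≤ x ^ (-(2 * cp) + 1) := Real.rpow_nonneg (by linarith) _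
        have h4 : -(2 * cp) + 1 = -(2 * cp - 1) := by ring
        rw [h4] at h3 ⊢
        rw [div_neg, ← neg_div]
        have : 0 < 2 * cp - 1 := by linarith
        gcongr
        linarith
      have h2 : ∫ y in (1:ℝ)..x, e y ≤ ∫ y in (1:ℝ)..x, Real.exp (2 * M) * y ^ (-(2 * cp)) := by
        refine integral_mono_on hx (hei 1 x) ?_ ?_
        · exact (intervalIntegrable_rpow (Or.inr h0)).const_mul _
        · intro y hy
          have hy0 : 0 < y := by linarith [hy.1]
          rw [Real.rpow_def_of_pos hy0, ← Real.exp_add]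
          apply Real.exp_le_exp.2
          rw [hA y hy.1]
          have := (abs_le.1 (htM y)).1
          nlinarith
      linarith
    rintro _ ⟨x, rfl⟩
    exact (hmono.monotone (le_max_left x 1)).trans (key _ (le_max_right x 1))

/-- The scale function `φ` is continuous and strictly increasing; it is bounded above iff
`c₊ > 1/2` and bounded below iff `c₋ > 1/2`. -/
theorem stmt4 (atil : ℝ → ℝ) (hatil : MeasureTheory.Integrable atil)
    (cp cm : ℝ) (a : ℝ → ℝ)
    (ha : ∀ x : ℝ, a x = atil x + (if 1 < x then cp else if x < -1 then cm else 0) / x)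
    (φ : ℝ → ℝ)
    (hφ : ∀ x, φ x = ∫ y in (0:ℝ)..x, Real.exp (-2 * ∫ z in (0:ℝ)..y, a z)) :
    Continuous φ ∧ StrictMono φ ∧
      (BddAbove (Set.range φ) ↔ 1 / 2 < cp) ∧
      (BddBelow (Set.range φ) ↔ 1 / 2 < cm) := by
  obtain ⟨h1, h2, h3⟩ := scale_half atil hatil cp cm a ha φ hφ
  refine ⟨h1, h2, h3, ?_⟩
  obtain ⟨-, -, h4⟩ := scale_half (fun x => -atil (-x)) hatil.comp_neg.neg cm cp
    (fun x => -a (-x)) (by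
      intro x
      simp only [ha]
      split_ifs <;> first | (exfalso; linarith) | (rw [div_neg]; ring))
    (fun x => -φ (-x)) (by
      intro x
      have hin : ∀ y : ℝ, ∫ z in (0:ℝ)..y, -a (-z) = ∫ z in (0:ℝ)..(-y), a z := by
        intro y
        rw [intervalIntegral.integral_neg, intervalIntegral.integral_comp_neg, neg_zero,
          ← intervalIntegral.integral_symm]
      simp only [hin]
      rw [intervalIntegral.integral_comp_neg
        (fun y => Real.exp (-2 * ∫ z in (0:ℝ)..y, a z)), neg_zero, hφ,
        ← intervalIntegral.integral_symm])
  rw [← h4]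
  constructor
  · rintro ⟨B, hB⟩
    refine ⟨-B, ?_⟩
    rintro _ ⟨x, rfl⟩
    exact neg_le_neg (hB ⟨-x, rfl⟩)
  · rintro ⟨B, hB⟩
    refine ⟨-B, ?_⟩
    rintro _ ⟨x, rfl⟩
    have := hB ⟨-x, rfl⟩
    simp only [neg_neg] at this
    linarith
end

section
/- If c₊ < 1/2, then lim_{x→+∞} φ(x) / x^{1−2c₊} = A(+∞) / (1 − 2c₊), where A(+∞) = exp(−2 ∫₀^{+∞} ã(z) dz). -/
open MeasureTheory Filter Set Topology intervalIntegral in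
/-- If `c₊ < 1/2`, then `φ(x)/x^{1−2c₊} → A(+∞)/(1−2c₊)` as `x → +∞`,
where `A(+∞) = exp(−2 ∫₀^∞ ã)`. -/
theorem stmt5 (atil : ℝ → ℝ) (hatil : MeasureTheory.Integrable atil)
    (cp cm : ℝ) (a : ℝ → ℝ)
    (ha : ∀ x : ℝ, a x = atil x + (if 1 < x then cp else if x < -1 then cm else 0) / x)
    (φ : ℝ → ℝ)
    (hφ : ∀ x, φ x = ∫ y in (0:ℝ)..x, Real.exp (-2 * ∫ z in (0:ℝ)..y, a z))
    (hcp : cp < 1 / 2) :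
    Filter.Tendsto (fun x : ℝ => φ x / x ^ (1 - 2 * cp)) Filter.atTop
      (nhds (Real.exp (-2 * ∫ z in Set.Ioi (0:ℝ), atil z) / (1 - 2 * cp))) := by
  obtain ⟨p, hp⟩ : ∃ p, p = 1 - 2 * cp := ⟨_, rfl⟩
  rw [← hp]
  have hp0 : 0 < p := by linarith
  set A : ℝ → ℝ := fun y => Real.exp (-2 * ∫ z in (0:ℝ)..y, atil z) with hA
  set L : ℝ := Real.exp (-2 * ∫ z in Set.Ioi (0:ℝ), atil z) with hL
  have hAlim : Tendsto A atTop (𝓝 L) := by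
    have h1 := intervalIntegral_tendsto_integral_Ioi (0:ℝ) hatil.integrableOn tendsto_id
    exact (Real.continuous_exp.tendsto _).comp (h1.const_mul (-2))
  have hAcont : Continuous A := by
    have h1 : Continuous fun y => ∫ z in (0:ℝ)..y, atil z :=
      intervalIntegral.continuous_primitive (fun _ _ => hatil.intervalIntegrable) 0
    fun_prop
  set M : ℝ := Real.exp (2 * ∫ z, ‖atil z‖) with hM
  have hAbd : ∀ y, ‖A y‖ ≤ M := by
    intro y
    rw [hA, hM, Real.norm_eq_abs, abs_of_pos (Real.exp_pos _)]
    apply Real.exp_le_exp.2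
    have h1 : ‖∫ z in (0:ℝ)..y, atil z‖ ≤ ∫ z, ‖atil z‖ := by
      refine (intervalIntegral.norm_integral_le_integral_norm_uIoc).trans ?_
      exact setIntegral_le_integral hatil.norm (Eventually.of_forall fun _ => norm_nonneg _)
    have := (abs_le.1 (Real.norm_eq_abs _ ▸ h1)).1
    linarith
  -- integrability of A y * y^(p-1)
  have hpow : ∀ u v : ℝ, IntervalIntegrable (fun y : ℝ => y ^ (p - 1)) volume u v :=
    fun u v => intervalIntegrable_rpow' (by linarith)
  have hint : ∀ u v : ℝ, IntervalIntegrable (fun y : ℝ => A y * y ^ (p - 1)) volume u v :=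
    fun u v => (hpow u v).continuousOn_mul hAcont.continuousOn
  -- formula on [0,1]
  have hb0 : ∀ y ∈ Icc (0:ℝ) 1, (if 1 < y then cp else if y < -1 then cm else 0) / y = 0 := by
    intro y hy
    rw [if_neg (not_lt.2 hy.2), if_neg (by have := hy.1; linarith), zero_div]
  set b : ℝ → ℝ := fun y => (if 1 < y then cp else if y < -1 then cm else 0) / y with hb
  have hb01 : ∀ y ∈ Icc (0:ℝ) 1, IntervalIntegrable b volume 0 y ∧ ∫ z in (0:ℝ)..y, b z = 0 := by
    intro y hy
    have h : EqOn b (fun _ => 0) (uIcc 0 y) := by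
      intro z hz
      rw [uIcc_of_le hy.1] at hz
      exact hb0 z ⟨hz.1, hz.2.trans hy.2⟩
    refine ⟨(intervalIntegrable_const (c := (0:ℝ))).congr ?_, ?_⟩
    · intro z hz
      exact (h (uIoc_subset_uIcc hz)).symm
    · rw [intervalIntegral.integral_congr h]; simp
  have hb1 : ∀ y, 1 ≤ y → IntervalIntegrable b volume 1 y ∧
      ∫ z in (1:ℝ)..y, b z = cp * Real.log y := by
    intro y hy
    have h : EqOn (fun z : ℝ => cp * z⁻¹) b (uIoc 1 y) := by
      intro z hz
      rw [uIoc_of_le hy] at hz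
      simp only [hb]
      rw [if_pos hz.1, div_eq_mul_inv]
    have h0 : (0:ℝ) ∉ uIcc 1 y := by
      rw [uIcc_of_le hy]; intro h; linarith [h.1]
    refine ⟨IntervalIntegrable.congr h ?_, ?_⟩
    · exact (intervalIntegrable_inv_iff.2 (Or.inr h0)).const_mul cp
    · rw [← intervalIntegral.integral_congr_ae (Eventually.of_forall fun z hz => h hz),
        intervalIntegral.integral_const_mul, integral_inv h0, div_one]
  have haeq : a = fun z => atil z + b z := funext ha
  have hg0 : ∀ y ∈ Icc (0:ℝ) 1, Real.exp (-2 * ∫ z in (0:ℝ)..y, a z) = A y := by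
    intro y hy
    rw [haeq, intervalIntegral.integral_add hatil.intervalIntegrable (hb01 y hy).1, (hb01 y hy).2,
      add_zero]
  have hg1 : ∀ y, 1 ≤ y → Real.exp (-2 * ∫ z in (0:ℝ)..y, a z) = A y * y ^ (p - 1) := by
    intro y hy
    have e := hb01 1 ⟨zero_le_one, le_rfl⟩
    rw [haeq, intervalIntegral.integral_add hatil.intervalIntegrable (e.1.trans (hb1 y hy).1),
      ← intervalIntegral.integral_add_adjacent_intervals e.1 (hb1 y hy).1, e.2, (hb1 y hy).2,
      Real.rpow_def_of_pos (by linarith), hA, ← Real.exp_add]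
    congr 1
    rw [hp]; ring
  set g : ℝ → ℝ := fun y => Real.exp (-2 * ∫ z in (0:ℝ)..y, a z) with hg
  have hgi0 : IntervalIntegrable g volume 0 1 := by
    refine (hAcont.intervalIntegrable 0 1).congr ?_
    intro y hy
    rw [uIoc_of_le zero_le_one] at hy
    exact (hg0 y ⟨hy.1.le, hy.2⟩).symm
  have hφ' : ∀ x, 1 ≤ x → φ x = ((∫ y in (0:ℝ)..1, g y) - ∫ y in (0:ℝ)..1, A y * y ^ (p - 1))
      + ∫ y in (0:ℝ)..x, A y * y ^ (p - 1) := by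
    intro x hx
    have h : EqOn (fun y => A y * y ^ (p - 1)) g (uIcc 1 x) := by
      intro y hy
      rw [uIcc_of_le hx] at hy
      exact (hg1 y hy.1).symm
    have hgi1 : IntervalIntegrable g volume 1 x :=
      (hint 1 x).congr fun y hy => h (uIoc_subset_uIcc hy)
    rw [hφ x, ← intervalIntegral.integral_add_adjacent_intervals hgi0 hgi1,
      ← intervalIntegral.integral_add_adjacent_intervals (hint 0 1) (hint 1 x),
      ← intervalIntegral.integral_congr h]
    ring
  have hscale : ∀ x : ℝ, 1 ≤ x → (∫ y in (0:ℝ)..x, A y * y ^ (p - 1)) / x ^ p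
      = ∫ t in (0:ℝ)..1, A (x * t) * t ^ (p - 1) := by
    intro x hx
    have hx0 : 0 < x := by linarith
    have h1 := intervalIntegral.integral_comp_mul_left (a := 0) (b := 1)
      (fun y => A y * y ^ (p - 1)) hx0.ne'
    have h2 : ∫ t in (0:ℝ)..1, A (x * t) * (x * t) ^ (p - 1)
        = x ^ (p - 1) * ∫ t in (0:ℝ)..1, A (x * t) * t ^ (p - 1) := by
      rw [← intervalIntegral.integral_const_mul]
      apply intervalIntegral.integral_congr
      intro t ht
      rw [uIcc_of_le zero_le_one] at ht
      simp only
      rw [Real.mul_rpow hx0.le ht.1]; ring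
    rw [h2, mul_zero, mul_one, smul_eq_mul, Real.rpow_sub_one hx0.ne'] at h1
    have := Real.rpow_pos_of_pos hx0 p
    field_simp at h1 ⊢
    linarith
  have hdct : Tendsto (fun x : ℝ => ∫ t in (0:ℝ)..1, A (x * t) * t ^ (p - 1)) atTop
      (𝓝 (∫ t in (0:ℝ)..1, L * t ^ (p - 1))) := by
    apply intervalIntegral.tendsto_integral_filter_of_dominated_convergence
      (fun t => M * ‖t ^ (p - 1)‖)
    · refine Eventually.of_forall fun x => ?_
      exact ((hAcont.comp (continuous_const.mul continuous_id)).aestronglyMeasurable).mul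
        (by fun_prop)
    · refine Eventually.of_forall fun x => Eventually.of_forall fun t _ => ?_
      rw [norm_mul]
      exact mul_le_mul_of_nonneg_right (hAbd _) (norm_nonneg _)
    · exact (hpow 0 1).norm.const_mul M
    · refine Eventually.of_forall fun t ht => ?_
      rw [uIoc_of_le zero_le_one] at ht
      exact (hAlim.comp (tendsto_id.atTop_mul_const ht.1)).mul_const _
  have hLval : ∫ t in (0:ℝ)..1, L * t ^ (p - 1) = L / p := by
    rw [intervalIntegral.integral_const_mul, integral_rpow (Or.inl (by linarith))]
    simp [hp0.ne', div_eq_mul_inv]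
  rw [hLval] at hdct
  have hK := (tendsto_rpow_atTop hp0).const_div_atTop
    ((∫ y in (0:ℝ)..1, g y) - ∫ y in (0:ℝ)..1, A y * y ^ (p - 1))
  have := hK.add hdct
  rw [zero_add] at this
  refine this.congr' ?_
  filter_upwards [eventually_ge_atTop (1:ℝ)] with x hx
  rw [hφ' x hx, add_div, hscale x hx]
end

section
/- If c₋ < 1/2, then lim_{x→+∞} φ(−x) / x^{1−2c₋} = −A(−∞) / (1 − 2c₋), where A(−∞) = exp(2 ∫_{−∞}^{0} ã(z) dz). -/
open MeasureTheory Filter Set in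
theorem kpart (cp cm : ℝ) (t : ℝ) (ht : 0 ≤ t) :
    IntervalIntegrable (fun x : ℝ => (if 1 < x then cp else if x < -1 then cm else 0) / x) volume 0 (-t) ∧
    ∫ x in (0:ℝ)..(-t), (if 1 < x then cp else if x < -1 then cm else 0) / x = cm * Real.log (max t 1) := by
  set k : ℝ → ℝ := fun x : ℝ => (if 1 < x then cp else if x < -1 then cm else 0) / x with hk
  have h0 : ∀ s : ℝ, 0 ≤ s → s ≤ 1 → Set.EqOn (fun _ => (0:ℝ)) k (Set.uIoc 0 (-s)) := by
    intro s hs hs1 x hx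
    rw [Set.uIoc_of_ge (by linarith)] at hx
    have h1 : ¬ 1 < x := by have := hx.2; linarith
    have h2 : ¬ x < -1 := by have := hx.1; linarith
    simp [hk, h1, h2]
  have i0 : ∀ s : ℝ, 0 ≤ s → s ≤ 1 → IntervalIntegrable k volume 0 (-s) := fun s hs hs1 =>
    (intervalIntegrable_const (c := (0:ℝ))).congr (h0 s hs hs1)
  have e0 : ∀ s : ℝ, 0 ≤ s → s ≤ 1 → ∫ x in (0:ℝ)..(-s), k x = 0 := fun s hs hs1 => by
    rw [← intervalIntegral.integral_congr_ae (ae_of_all _ (fun x hx => h0 s hs hs1 hx))]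
    simp
  rcases le_or_gt t 1 with h | h
  · refine ⟨i0 t ht h, ?_⟩
    rw [max_eq_right h, Real.log_one, mul_zero]
    exact e0 t ht h
  · have hae : ∀ᵐ x ∂(volume : Measure ℝ), x ∈ Set.uIoc (-1) (-t) → cm * x⁻¹ = k x := by
      have : ∀ᵐ x ∂(volume : Measure ℝ), x ≠ -1 := by simp [ae_iff]
      filter_upwards [this] with x hx1 hx
      rw [Set.uIoc_of_ge (by linarith)] at hx
      have h1 : ¬ 1 < x := by have := hx.2; linarith
      have h2 : x < -1 := lt_of_le_of_ne hx.2 hx1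
      simp [hk, h1, h2, div_eq_mul_inv]
    have h00 : (0:ℝ) ∉ Set.uIcc (-1) (-t) := by
      rw [Set.uIcc_of_ge (by linarith)]
      intro hx; have := hx.2; linarith
    have i1 : IntervalIntegrable k volume (-1) (-t) := by
      refine IntervalIntegrable.congr_ae (f := fun x => cm * x⁻¹) ?_ ((ae_restrict_iff' measurableSet_uIoc).2 hae)
      apply IntervalIntegrable.const_mul
      apply intervalIntegral.intervalIntegrable_inv (f := fun x => x)
      · intro x hx h; exact h00 (h ▸ hx)
      · fun_prop
    have e1 : ∫ x in (-1:ℝ)..(-t), k x = cm * Real.log t := by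
      rw [← intervalIntegral.integral_congr_ae hae, intervalIntegral.integral_const_mul, integral_inv h00]
      simp
    refine ⟨(i0 1 zero_le_one le_rfl).trans i1, ?_⟩
    rw [max_eq_left h.le, ← intervalIntegral.integral_add_adjacent_intervals (i0 1 zero_le_one le_rfl) i1,
      e0 1 zero_le_one le_rfl, e1, zero_add]

open MeasureTheory Filter Set in
/-- If `c₋ < 1/2`, then `φ(−x)/x^{1−2c₋} → −A(−∞)/(1−2c₋)` as `x → +∞`,
where `A(−∞) = exp(2 ∫_{−∞}^0 ã)`. -/
theorem stmt6 (atil : ℝ → ℝ) (hatil : MeasureTheory.Integrable atil)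
    (cp cm : ℝ) (a : ℝ → ℝ)
    (ha : ∀ x : ℝ, a x = atil x + (if 1 < x then cp else if x < -1 then cm else 0) / x)
    (φ : ℝ → ℝ)
    (hφ : ∀ x, φ x = ∫ y in (0:ℝ)..x, Real.exp (-2 * ∫ z in (0:ℝ)..y, a z))
    (hcm : cm < 1 / 2) :
    Filter.Tendsto (fun x : ℝ => φ (-x) / x ^ (1 - 2 * cm)) Filter.atTop
      (nhds (-(Real.exp (2 * ∫ z in Set.Iic (0:ℝ), atil z)) / (1 - 2 * cm))) := by
  obtain ⟨p, hp⟩ : ∃ p : ℝ, p = -2 * cm := ⟨_, rfl⟩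
  have hp1 : -1 < p := by linarith
  set A : ℝ := Real.exp (2 * ∫ z in Set.Iic (0:ℝ), atil z) with hA
  set h : ℝ → ℝ := fun t => Real.exp (2 * ∫ z in (-t)..0, atil z) with hh
  have hcont : Continuous h := by
    have : Continuous fun t => ∫ z in (0:ℝ)..t, atil z :=
      intervalIntegral.continuous_primitive (fun a b => hatil.intervalIntegrable) 0
    have h2 : h = fun t => Real.exp (2 * -(∫ z in (0:ℝ)..(-t), atil z)) := by
      funext t; simp only [hh]; rw [intervalIntegral.integral_symm]
    rw [h2]
    have h3 : Continuous fun t => ∫ z in (0:ℝ)..(-t), atil z := this.comp continuous_neg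
    fun_prop
  have hlim : Tendsto h atTop (nhds A) := by
    refine (Real.continuous_exp.tendsto _).comp (Tendsto.const_mul 2 ?_)
    exact intervalIntegral_tendsto_integral_Iic 0 hatil.integrableOn tendsto_neg_atTop_atBot
  obtain ⟨M, hM⟩ : ∃ M : ℝ, ∀ t, |h t| ≤ M := by
    refine ⟨Real.exp (2 * ∫ z, ‖atil z‖), fun t => ?_⟩
    rw [abs_of_pos (Real.exp_pos _)]
    apply Real.exp_le_exp.2
    have h1 := (le_abs_self (∫ z in (-t)..0, atil z)).trans
      (intervalIntegral.norm_integral_le_integral_norm_uIoc (f := atil) (μ := volume))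
    have h2 : ∫ z in Set.uIoc (-t) 0, ‖atil z‖ ≤ ∫ z, ‖atil z‖ :=
      setIntegral_le_integral hatil.norm (ae_of_all _ fun x => norm_nonneg _)
    linarith
  have hg : ∀ t, 0 ≤ t → Real.exp (-2 * ∫ z in (0:ℝ)..(-t), a z) = h t * (max t 1) ^ p := by
    intro t ht
    obtain ⟨hi, he⟩ := kpart cp cm t ht
    have : ∫ z in (0:ℝ)..(-t), a z = -(∫ z in (-t)..0, atil z) + cm * Real.log (max t 1) := by
      simp only [ha]
      rw [intervalIntegral.integral_add hatil.intervalIntegrable hi, he, intervalIntegral.integral_symm]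
    rw [this, Real.rpow_def_of_pos (by positivity), hh, ← Real.exp_add, hp]
    congr 1; ring
  -- rescaling
  have hkey : ∀ x : ℝ, 0 < x → φ (-x) / x ^ (1 - 2 * cm)
      = -∫ s in (0:ℝ)..1, h (x * s) * (max s (1 / x)) ^ p := by
    intro x hx
    have e1 : φ (-x) = -∫ t in (0:ℝ)..x, h t * (max t 1) ^ p := by
      rw [hφ, intervalIntegral.integral_symm]
      congr 1
      have := intervalIntegral.integral_comp_neg (a := 0) (b := x)
        (fun y => Real.exp (-2 * ∫ z in (0:ℝ)..y, a z))
      rw [neg_zero] at this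
      rw [← this]
      apply intervalIntegral.integral_congr
      intro t ht
      rw [Set.uIcc_of_le hx.le] at ht
      exact hg t ht.1
    have e2 := intervalIntegral.mul_integral_comp_mul_left (a := 0) (b := 1)
      (f := fun t => h t * (max t 1) ^ p) x
    rw [mul_zero, mul_one] at e2
    rw [e1, ← e2, neg_div, mul_comm, show 1 - 2 * cm = p + 1 by rw [hp]; ring,
      Real.rpow_add_one hx.ne', mul_div_mul_right _ _ hx.ne', ← intervalIntegral.integral_div]
    congr 1
    apply intervalIntegral.integral_congr
    intro s hs
    simp only
    rw [mul_div_assoc, ← Real.div_rpow (by positivity) hx.le, ← max_div_div_right hx.le,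
      mul_div_cancel_left₀ _ hx.ne']
  have hint : ∫ s in (0:ℝ)..1, A * s ^ p = A / (1 - 2 * cm) := by
    rw [intervalIntegral.integral_const_mul, integral_rpow (Or.inl hp1), Real.one_rpow,
      Real.zero_rpow (by linarith), hp]
    rw [show -2 * cm + 1 = 1 - 2 * cm by ring]; ring
  rw [neg_div, ← hint]
  have hmain : Tendsto (fun x : ℝ => ∫ s in (0:ℝ)..1, h (x * s) * (max s (1 / x)) ^ p) atTop
      (nhds (∫ s in (0:ℝ)..1, A * s ^ p)) := by
    apply intervalIntegral.tendsto_integral_filter_of_dominated_convergence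
      (fun s => M * (s ^ p + 1))
    · filter_upwards with x
      apply Measurable.aestronglyMeasurable
      have := hcont.measurable
      fun_prop
    · filter_upwards [eventually_ge_atTop 1] with x hx
      refine ae_of_all _ fun s hs => ?_
      rw [Set.uIoc_of_le zero_le_one] at hs
      have hs0 := hs.1
      have hm : 0 < max s (1 / x) := lt_max_of_lt_left hs0
      have hm1 : max s (1 / x) ≤ 1 := max_le hs.2 (by rw [div_le_one (by linarith)]; exact hx)
      rw [norm_mul, Real.norm_eq_abs, Real.norm_eq_abs, abs_of_pos (Real.rpow_pos_of_pos hm p)]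
      refine mul_le_mul (hM _) ?_ (Real.rpow_pos_of_pos hm p).le ((abs_nonneg _).trans (hM 0))
      have hsp := Real.rpow_pos_of_pos hs0 p
      rcases le_total 0 p with h0 | h0
      · have := Real.rpow_le_one hm.le hm1 h0
        linarith
      · have := Real.rpow_le_rpow_of_nonpos hs0 (le_max_left s (1 / x)) h0
        linarith
    · exact ((intervalIntegral.intervalIntegrable_rpow' hp1).add intervalIntegrable_const).const_mul M
    · refine ae_of_all _ fun s hs => ?_
      rw [Set.uIoc_of_le zero_le_one] at hs
      have hs0 := hs.1
      refine Tendsto.mul (hlim.comp (tendsto_id.atTop_mul_const hs0)) ?_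
      refine tendsto_const_nhds.congr' ?_
      filter_upwards [eventually_ge_atTop (1 / s)] with x hx
      have hx0 : 0 < x := lt_of_lt_of_le (by positivity) hx
      rw [max_eq_left]
      rw [div_le_iff₀ hx0]
      rw [div_le_iff₀ hs0] at hx
      linarith
  refine hmain.neg.congr' ?_
  filter_upwards [eventually_gt_atTop 0] with x hx
  exact (hkey x hx).symm
end

section
/- If c₊ = 1/2, then lim_{x→+∞} φ(x) / ln x = A(+∞), where A(+∞) = exp(−2 ∫₀^{+∞} ã(z) dz); similarly, if c₋ = 1/2, then lim_{x→+∞} φ(−x) / ln x = −A(−∞), where A(−∞) = exp(2 ∫_{−∞}^{0} ã(z) dz). -/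
open MeasureTheory Filter Topology Set

theorem aux_core (g : ℝ → ℝ) (hg : Continuous g) (L : ℝ)
    (h : Tendsto (fun y => g y * y) atTop (𝓝 L)) :
    Tendsto (fun x => (∫ y in (0:ℝ)..x, g y) / Real.log x) atTop (𝓝 L) := by
  have hlog := Real.tendsto_log_atTop
  suffices hD : (fun x => (∫ y in (0:ℝ)..x, g y) - L * Real.log x) =o[atTop] Real.log by
    have h1 := hD.tendsto_div_nhds_zero.add_const L
    rw [zero_add] at h1
    refine h1.congr' ?_
    filter_upwards [hlog.eventually_gt_atTop 0] with x hx
    field_simp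
    ring
  rw [Asymptotics.isLittleO_iff]
  intro ε hε
  obtain ⟨X, hX⟩ := eventually_atTop.1 (Metric.tendsto_nhds.1 h (ε / 2) (by positivity))
  set Y := max X 1 with hY
  have hY1 : 1 ≤ Y := le_max_right _ _
  set C := (∫ y in (0:ℝ)..Y, g y) - L * Real.log Y with hC
  filter_upwards [hlog.eventually_ge_atTop (|C| / (ε / 2)), eventually_ge_atTop Y] with x hx hxY
  have hx1 : 1 ≤ x := hY1.trans hxY
  have hlx : 0 ≤ Real.log x := Real.log_nonneg hx1
  have hlY : 0 ≤ Real.log Y := Real.log_nonneg hY1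
  have hinv : ∫ y in Y..x, y⁻¹ = Real.log x - Real.log Y := by
    rw [integral_inv_of_pos (by linarith) (by linarith), Real.log_div (by linarith) (by linarith)]
  have hii : IntervalIntegrable (fun y : ℝ => y⁻¹) volume Y x := by
    apply intervalIntegral.intervalIntegrable_inv
    · intro y hy
      rw [uIcc_of_le hxY] at hy
      have := hy.1
      linarith
    · exact continuousOn_id
  have e1 : (∫ y in (0:ℝ)..x, g y) - L * Real.log x = C + ∫ y in Y..x, (g y - L * y⁻¹) := by
    rw [intervalIntegral.integral_sub (hg.intervalIntegrable _ _) (hii.const_mul L),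
      intervalIntegral.integral_const_mul, hinv,
      ← intervalIntegral.integral_add_adjacent_intervals (hg.intervalIntegrable 0 Y)
        (hg.intervalIntegrable Y x)]
    rw [hC]; ring
  have e2 : ‖∫ y in Y..x, (g y - L * y⁻¹)‖ ≤ ∫ y in Y..x, (ε / 2) * y⁻¹ := by
    apply intervalIntegral.norm_integral_le_of_norm_le hxY
    · refine Eventually.of_forall fun y hy => ?_
      have hy0 : 0 < y := by linarith [hy.1]
      have h2 := hX y ((le_max_left _ _).trans hy.1.le)
      rw [Real.dist_eq] at h2
      have : g y - L * y⁻¹ = (g y * y - L) * y⁻¹ := by field_simp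
      rw [this, norm_mul, Real.norm_eq_abs, Real.norm_eq_abs, abs_of_pos (inv_pos.2 hy0)]
      gcongr
    · exact hii.const_mul _
  rw [intervalIntegral.integral_const_mul, hinv] at e2
  rw [e1, Real.norm_eq_abs (Real.log x), abs_of_nonneg hlx]
  have h3 := norm_add_le C (∫ y in Y..x, (g y - L * y⁻¹))
  rw [div_le_iff₀ (by positivity)] at hx
  rw [Real.norm_eq_abs C] at h3
  nlinarith

theorem aux_side (b a : ℝ → ℝ) (hb : Integrable b)
    (ha : ∀ x, 0 ≤ x → a x = b x + (if 1 < x then 1 / 2 else 0) / x) :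
    Tendsto (fun x => (∫ y in (0:ℝ)..x, Real.exp (-2 * ∫ z in (0:ℝ)..y, a z)) / Real.log x) atTop
      (𝓝 (Real.exp (-2 * ∫ z in Ioi (0:ℝ), b z))) := by
  set k : ℝ → ℝ := fun x => (if 1 < x then 1 / 2 else 0) / x with hk
  have hkm : Measurable k :=
    (Measurable.ite measurableSet_Ioi measurable_const measurable_const).div measurable_id
  have hki : ∀ u v, IntervalIntegrable k volume u v := by
    intro u v
    refine (intervalIntegrable_const (c := (1:ℝ))).mono_fun hkm.aestronglyMeasurable
      (Eventually.of_forall fun x => ?_)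
    simp only [hk]
    split_ifs with h
    · rw [Real.norm_eq_abs, abs_of_pos (by positivity), norm_one, div_le_iff₀ (by linarith)]
      linarith
    · simp
  have hbi : ∀ u v, IntervalIntegrable b volume u v := fun u v => hb.intervalIntegrable
  have hci : ∀ u v, IntervalIntegrable (fun x => b x + k x) volume u v :=
    fun u v => (hbi u v).add (hki u v)
  set g : ℝ → ℝ := fun y => Real.exp (-2 * ∫ z in (0:ℝ)..y, (b z + k z)) with hgdef
  have hg : Continuous g :=
    Real.continuous_exp.comp (continuous_const.mul (intervalIntegral.continuous_primitive hci 0))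
  have hlim : Tendsto (fun y => g y * y) atTop (𝓝 (Real.exp (-2 * ∫ z in Ioi (0:ℝ), b z))) := by
    have h1 : Tendsto (fun y => ∫ z in (0:ℝ)..y, b z) atTop (𝓝 (∫ z in Ioi (0:ℝ), b z)) :=
      intervalIntegral_tendsto_integral_Ioi 0 hb.integrableOn tendsto_id
    have h2 := (Real.continuous_exp.tendsto _).comp (h1.const_mul (-2))
    refine h2.congr' ?_
    filter_upwards [eventually_ge_atTop 1] with y hy
    have k1 : ∫ z in (0:ℝ)..1, k z = 0 := by
      refine Eq.trans (b := ∫ z in (0:ℝ)..1, (0:ℝ)) ?_ (by simp)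
      apply intervalIntegral.integral_congr
      intro z hz
      rw [uIcc_of_le zero_le_one] at hz
      simp [hk, not_lt.2 hz.2]
    have k2 : ∫ z in (1:ℝ)..y, k z = 1 / 2 * Real.log y := by
      rw [show (1/2 * Real.log y) = ∫ z in (1:ℝ)..y, 1 / 2 * z⁻¹ by
        rw [intervalIntegral.integral_const_mul, integral_inv_of_pos one_pos (by linarith), div_one]]
      apply intervalIntegral.integral_congr_ae
      refine Eventually.of_forall fun z hz => ?_
      rw [uIoc_of_le hy] at hz
      simp only [hk, if_pos hz.1, div_eq_mul_inv]
    simp only [hgdef, Function.comp]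
    rw [intervalIntegral.integral_add (hbi _ _) (hki _ _),
      ← intervalIntegral.integral_add_adjacent_intervals (hki 0 1) (hki 1 y), k1, k2]
    nth_rewrite 4 [← Real.exp_log (show 0 < y by linarith)]
    rw [← Real.exp_add]
    congr 1
    ring
  refine (aux_core g hg _ hlim).congr' ?_
  filter_upwards [eventually_ge_atTop 0] with x hx
  congr 1
  apply intervalIntegral.integral_congr
  intro y hy
  rw [uIcc_of_le hx] at hy
  simp only [hgdef]
  congr 2
  apply intervalIntegral.integral_congr
  intro z hz
  rw [uIcc_of_le hy.1] at hz
  exact (ha z hz.1).symm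


/-- If `c₊ = 1/2`, then `φ(x)/ln x → A(+∞)` as `x → +∞`; similarly, if `c₋ = 1/2`, then
`φ(−x)/ln x → −A(−∞)` as `x → +∞`. -/
theorem stmt7 (atil : ℝ → ℝ) (hatil : MeasureTheory.Integrable atil)
    (cp cm : ℝ) (a : ℝ → ℝ)
    (ha : ∀ x : ℝ, a x = atil x + (if 1 < x then cp else if x < -1 then cm else 0) / x)
    (φ : ℝ → ℝ)
    (hφ : ∀ x, φ x = ∫ y in (0:ℝ)..x, Real.exp (-2 * ∫ z in (0:ℝ)..y, a z)) :
    (cp = 1 / 2 →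
      Filter.Tendsto (fun x : ℝ => φ x / Real.log x) Filter.atTop
        (nhds (Real.exp (-2 * ∫ z in Set.Ioi (0:ℝ), atil z)))) ∧
    (cm = 1 / 2 →
      Filter.Tendsto (fun x : ℝ => φ (-x) / Real.log x) Filter.atTop
        (nhds (-(Real.exp (2 * ∫ z in Set.Iic (0:ℝ), atil z))))) := by
  constructor
  · rintro rfl
    simp only [hφ]
    refine aux_side atil a hatil fun x hx => ?_
    rw [ha, if_neg (show ¬ x < -1 by linarith)]
  · rintro rfl
    have h := (aux_side (fun x => -atil (-x)) (fun x => -a (-x)) hatil.comp_neg.neg ?_).neg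
    · have e : ∫ z in Ioi (0:ℝ), -atil (-z) = -∫ z in Iic (0:ℝ), atil z := by
        rw [integral_neg, integral_comp_neg_Ioi, neg_zero]
      rw [e, neg_mul_neg] at h
      refine h.congr fun x => ?_
      rw [hφ, ← neg_div]
      congr 1
      have e2 : ∀ y, ∫ z in (0:ℝ)..y, -a (-z) = ∫ z in (0:ℝ)..(-y), a z := by
        intro y
        rw [intervalIntegral.integral_neg, intervalIntegral.integral_comp_neg, neg_zero,
          ← intervalIntegral.integral_symm]
      simp only [e2]
      rw [intervalIntegral.integral_comp_neg (fun y => Real.exp (-2 * ∫ z in (0:ℝ)..y, a z)),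
        neg_zero, ← intervalIntegral.integral_symm]
    · intro x hx
      simp only [ha]
      rw [if_neg (show ¬ 1 < -x by linarith)]
      simp only [neg_lt_neg_iff, div_neg]
      ring
end

section
/- If c₊ > 1/2, then φ(x) converges as x → +∞ to the finite limit ∫₀^{∞} A(y) · max(y,1)^{−2c₊} dy, where A(y) = exp(−2 ∫₀ʸ ã(z) dz); similarly, if c₋ > 1/2, then φ(−x) converges as x → +∞ to the finite limit −∫₀^{∞} A(−y) · max(y,1)^{−2c₋} dy. -/
open MeasureTheory Set in
lemma ii_congr_uIoc {f g : ℝ → ℝ} {a b : ℝ} (h : EqOn f g (uIoc a b)) :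
    ∫ x in a..b, f x = ∫ x in a..b, g x :=
  intervalIntegral.integral_congr_ae (ae_of_all _ fun _ hx => h hx)

open MeasureTheory Set Filter in
lemma core_inner (c y : ℝ) (hy : 0 ≤ y) :
    IntervalIntegrable (fun x : ℝ => (if 1 < x then c else 0) / x) volume 0 y ∧
    ∫ x in (0:ℝ)..y, (if 1 < x then c else 0) / x = c * Real.log (max y 1) := by
  have small : ∀ t : ℝ, 0 ≤ t → t ≤ 1 → 
      IntervalIntegrable (fun x : ℝ => (if 1 < x then c else 0) / x) volume 0 t ∧
      ∫ x in (0:ℝ)..t, (if 1 < x then c else 0) / x = 0 := by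
    intro t ht ht1
    have e : EqOn (fun _ : ℝ => (0:ℝ)) (fun x : ℝ => (if 1 < x then c else 0) / x) (uIoc 0 t) := by
      intro x hx
      rw [uIoc_of_le ht] at hx
      have : ¬ (1 < x) := not_lt.mpr (hx.2.trans ht1)
      simp [this]
    refine ⟨(intervalIntegrable_const (c := (0:ℝ))).congr e, ?_⟩
    rw [← ii_congr_uIoc e]
    simp
  rcases le_total y 1 with h1 | h1
  · have := small y hy h1
    rw [max_eq_right h1]
    simpa using this
  · have e : EqOn (fun x : ℝ => c * x⁻¹) (fun x : ℝ => (if 1 < x then c else 0) / x) (uIoc 1 y) := by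
      intro x hx
      rw [uIoc_of_le h1] at hx
      simp [hx.1, div_eq_mul_inv]
    have n0 : (0:ℝ) ∉ uIcc 1 y := by
      rw [uIcc_of_le h1]; intro h; linarith [h.1]
    have i0 : IntervalIntegrable (fun x : ℝ => c * x⁻¹) volume 1 y := by
      apply ContinuousOn.intervalIntegrable
      refine continuousOn_const.mul (continuousOn_inv₀.mono ?_)
      intro x hx h
      rw [mem_singleton_iff] at h; subst h; exact n0 hx
    have i1 := i0.congr e
    obtain ⟨i2, e2⟩ := small 1 zero_le_one le_rfl
    refine ⟨i2.trans i1, ?_⟩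
    rw [← intervalIntegral.integral_add_adjacent_intervals i2 i1, e2,
      ← ii_congr_uIoc e, intervalIntegral.integral_const_mul,
      integral_inv n0, max_eq_left h1]
    simp

open MeasureTheory Set Filter in
lemma core (b : ℝ → ℝ) (hb : Integrable b) (c : ℝ) (hc : 1 / 2 < c) (g : ℝ → ℝ)
    (hg : ∀ x, 0 < x → g x = b x + (if 1 < x then c else 0) / x) :
    IntegrableOn (fun y : ℝ => Real.exp (-2 * ∫ z in (0:ℝ)..y, b z) * max y 1 ^ (-(2 * c))) (Ioi 0) ∧
    Tendsto (fun x : ℝ => ∫ y in (0:ℝ)..x, Real.exp (-2 * ∫ z in (0:ℝ)..y, g z)) atTop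
      (nhds (∫ y in Ioi (0:ℝ),
        Real.exp (-2 * ∫ z in (0:ℝ)..y, b z) * max y 1 ^ (-(2 * c)))) := by
  have int : IntegrableOn
      (fun y : ℝ => Real.exp (-2 * ∫ z in (0:ℝ)..y, b z) * max y 1 ^ (-(2 * c))) (Ioi 0) := by
    have m : IntegrableOn (fun y : ℝ => max y 1 ^ (-(2 * c))) (Ioi 0) := by
      rw [← Ioc_union_Ioi_eq_Ioi (zero_le_one (α := ℝ))]
      refine IntegrableOn.union ?_ ?_
      · have : IntegrableOn (fun _ : ℝ => (1:ℝ)) (Ioc 0 1) := by simp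
        refine this.congr_fun ?_ measurableSet_Ioc
        intro x hx
        simp [max_eq_right hx.2]
      · have : IntegrableOn (fun y : ℝ => y ^ (-(2 * c))) (Ioi 1) :=
          integrableOn_Ioi_rpow_of_lt (by linarith) one_pos
        refine this.congr_fun ?_ measurableSet_Ioi
        intro x hx
        simp [max_eq_left (le_of_lt (mem_Ioi.mp hx))]
    refine Integrable.bdd_mul (c := Real.exp (2 * ∫ z, ‖b z‖)) m ?_ ?_
    · have : Continuous fun y : ℝ => ∫ z in (0:ℝ)..y, b z :=
        intervalIntegral.continuous_primitive (fun _ _ => hb.intervalIntegrable) 0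
      have : Continuous fun y : ℝ => Real.exp (-2 * ∫ z in (0:ℝ)..y, b z) := by fun_prop
      exact this.aestronglyMeasurable
    · refine Eventually.of_forall fun y => ?_
      rw [Real.norm_eq_abs, Real.abs_exp, Real.exp_le_exp]
      have h1 : ‖∫ z in (0:ℝ)..y, b z‖ ≤ ∫ z in uIoc 0 y, ‖b z‖ :=
        intervalIntegral.norm_integral_le_integral_norm_uIoc
      have h2 : ∫ z in uIoc 0 y, ‖b z‖ ≤ ∫ z, ‖b z‖ :=
        setIntegral_le_integral hb.norm (Eventually.of_forall fun _ => norm_nonneg _)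
      have h3 := neg_abs_le (∫ z in (0:ℝ)..y, b z)
      rw [Real.norm_eq_abs] at h1
      linarith
  refine ⟨int, ?_⟩
  refine (intervalIntegral_tendsto_integral_Ioi 0 int tendsto_id).congr' ?_
  filter_upwards [eventually_ge_atTop 0] with x hx
  refine ii_congr_uIoc fun y hy => ?_
  simp only [id] at hy
  rw [uIoc_of_le hx] at hy
  obtain ⟨i, e⟩ := core_inner c y hy.1.le
  have : ∫ z in (0:ℝ)..y, g z = (∫ z in (0:ℝ)..y, b z) + c * Real.log (max y 1) := by
    rw [← e, ← intervalIntegral.integral_add hb.intervalIntegrable i]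
    refine ii_congr_uIoc fun z hz => ?_
    rw [uIoc_of_le hy.1.le] at hz
    exact hg z hz.1
  simp only [this]
  rw [Real.rpow_def_of_pos (by positivity), ← Real.exp_add]
  congr 1
  ring

/-- If `c₊ > 1/2`, then `φ(x)` converges as `x → +∞` to the finite limit
`∫₀^∞ A(y)·max(y,1)^{−2c₊} dy`; similarly, if `c₋ > 1/2`, then `φ(−x)` converges to
`−∫₀^∞ A(−y)·max(y,1)^{−2c₋} dy`. -/
theorem stmt8 (atil : ℝ → ℝ) (hatil : MeasureTheory.Integrable atil)
    (cp cm : ℝ) (a : ℝ → ℝ)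
    (ha : ∀ x : ℝ, a x = atil x + (if 1 < x then cp else if x < -1 then cm else 0) / x)
    (A : ℝ → ℝ)
    (hA : ∀ y, A y = Real.exp (-2 * ∫ z in (0:ℝ)..y, atil z))
    (φ : ℝ → ℝ)
    (hφ : ∀ x, φ x = ∫ y in (0:ℝ)..x, Real.exp (-2 * ∫ z in (0:ℝ)..y, a z)) :
    (1 / 2 < cp →
      MeasureTheory.IntegrableOn (fun y : ℝ => A y * max y 1 ^ (-(2 * cp))) (Set.Ioi 0) ∧
      Filter.Tendsto φ Filter.atTop
        (nhds (∫ y in Set.Ioi (0:ℝ), A y * max y 1 ^ (-(2 * cp))))) ∧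
    (1 / 2 < cm →
      MeasureTheory.IntegrableOn (fun y : ℝ => A (-y) * max y 1 ^ (-(2 * cm))) (Set.Ioi 0) ∧
      Filter.Tendsto (fun x : ℝ => φ (-x)) Filter.atTop
        (nhds (-∫ y in Set.Ioi (0:ℝ), A (-y) * max y 1 ^ (-(2 * cm))))) := by
  constructor
  · intro hc
    have k := core atil hatil cp hc a (fun x hx => by
      have : ¬ x < -1 := by linarith
      rw [ha]; simp [this])
    obtain rfl : A = _ := funext hA
    obtain rfl : φ = _ := funext hφ
    exact k
  · intro hc
    have k := core (fun x => -atil (-x)) hatil.comp_neg.neg cm hc (fun x => -a (-x)) (fun x hx => by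
      have h1 : ¬ 1 < -x := by linarith
      simp only [ha, h1, if_false, neg_lt_neg_iff, div_neg]
      ring)
    have key : ∀ (f : ℝ → ℝ) (y : ℝ), ∫ z in (0:ℝ)..y, -f (-z) = ∫ z in (0:ℝ)..(-y), f z := by
      intro f y
      rw [intervalIntegral.integral_neg, intervalIntegral.integral_comp_neg,
        intervalIntegral.integral_symm]
      simp
    simp only [key] at k
    simp only [hA]
    refine ⟨k.1, k.2.neg.congr fun x => ?_⟩
    rw [hφ, ← key, intervalIntegral.integral_neg]
end

section
/- Assume c₋ < 1/2 and c₋ < c₊. Fix α > 0 and x ∈ (−α, α). Then the ratio (φ(n x) − φ(−n α)) / (φ(n α) − φ(−n α)) converges as n → ∞ to 1 if x ≥ 0, and to 1 − (−x/α)^{1−2c₋} if x < 0. -/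
open MeasureTheory Filter Topology Set

/-- The step function divided by `x`. -/
noncomputable def stepq (c d : ℝ) (x : ℝ) : ℝ :=
  (if 1 < x then c else if x < -1 then d else 0) / x

lemma stepq_neg (c d x : ℝ) : -stepq c d (-x) = stepq d c x := by
  unfold stepq
  have e1 : (1 < -x) ↔ x < -1 := by constructor <;> intro h <;> linarith
  have e2 : (-x < -1) ↔ 1 < x := by constructor <;> intro h <;> linarith
  simp only [e1, e2, div_neg, neg_neg]
  by_cases h1 : 1 < x
  · have : ¬ x < -1 := by linarith
    simp [h1, this]
  · by_cases h2 : x < -1 <;> simp [h1, h2]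

lemma stepq_meas (c d : ℝ) : Measurable (stepq c d) := by
  unfold stepq
  refine Measurable.div ?_ measurable_id
  refine Measurable.ite measurableSet_Ioi measurable_const ?_
  exact Measurable.ite measurableSet_Iio measurable_const measurable_const

lemma stepq_bound (c d x : ℝ) : ‖stepq c d x‖ ≤ |c| + |d| := by
  unfold stepq
  rw [Real.norm_eq_abs, abs_div]
  have hc := abs_nonneg c
  have hd := abs_nonneg d
  split_ifs with h1 h2
  · refine (div_le_self hc ?_).trans (by linarith)
    rw [abs_of_pos (by linarith)]; linarith
  · refine (div_le_self hd ?_).trans (by linarith)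
    rw [abs_of_neg (by linarith)]; linarith
  · simp; linarith

lemma stepq_int (c d u v : ℝ) : IntervalIntegrable (stepq c d) volume u v := by
  refine (intervalIntegrable_const (c := |c| + |d|)).mono_fun
    (stepq_meas c d).aestronglyMeasurable ?_
  refine Eventually.of_forall fun x => ?_
  refine (stepq_bound c d x).trans ?_
  exact Real.le_norm_self _

lemma stepq_integral (c d y : ℝ) (hy : 1 ≤ y) :
    ∫ z in (0:ℝ)..y, stepq c d z = c * Real.log y := by
  rw [← intervalIntegral.integral_add_adjacent_intervals (stepq_int c d 0 1) (stepq_int c d 1 y)]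
  have h1 : ∫ z in (0:ℝ)..1, stepq c d z = 0 := by
    rw [intervalIntegral.integral_congr_uIoo (g := fun _ => 0)]
    · simp
    · intro z hz
      rw [uIoo_of_le zero_le_one] at hz
      have e1 : ¬ 1 < z := by linarith [hz.2]
      have e2 : ¬ z < -1 := by linarith [hz.1]
      simp [stepq, e1, e2]
  have h2 : ∫ z in (1:ℝ)..y, stepq c d z = ∫ z in (1:ℝ)..y, c * z⁻¹ := by
    apply intervalIntegral.integral_congr_uIoo
    intro z hz
    rw [uIoo_of_le hy] at hz
    simp [stepq, hz.1, div_eq_mul_inv]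
  rw [h1, h2, intervalIntegral.integral_const_mul, integral_inv_of_pos one_pos (by linarith)]
  simp

/-- density of the scale function. -/
noncomputable def dens (b : ℝ → ℝ) (c d : ℝ) (y : ℝ) : ℝ :=
  Real.exp (-2 * ∫ z in (0:ℝ)..y, (b z + stepq c d z))

lemma dens_cont (b : ℝ → ℝ) (hb : Integrable b) (c d : ℝ) : Continuous (dens b c d) := by
  unfold dens
  refine Real.continuous_exp.comp (continuous_const.mul ?_)
  exact intervalIntegral.continuous_primitive
    (fun u v => (hb.intervalIntegrable).add (stepq_int c d u v)) 0

lemma dens_neg (b : ℝ → ℝ) (c d y : ℝ) :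
    dens b c d (-y) = dens (fun z => -b (-z)) d c y := by
  unfold dens
  congr 2
  have := intervalIntegral.integral_comp_neg (a := 0) (b := y) (fun z => b z + stepq c d z)
  rw [neg_zero] at this
  rw [intervalIntegral.integral_symm, ← this, ← intervalIntegral.integral_neg]
  congr 1
  ext z
  rw [← stepq_neg c d z]; ring

lemma dens_lim (b : ℝ → ℝ) (hb : Integrable b) (c d e : ℝ) :
    ∃ E : ℝ, 0 < E ∧ Tendsto (fun y => dens b c d y * y ^ (2 * c)) atTop (𝓝 E) := by
  refine ⟨Real.exp (-2 * ∫ z in Ioi (0:ℝ), b z), Real.exp_pos _, ?_⟩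
  have h := intervalIntegral_tendsto_integral_Ioi (0:ℝ) hb.integrableOn tendsto_id
  have h' := (Real.continuous_exp.tendsto _).comp (h.const_mul (-2))
  refine h'.congr' ?_
  filter_upwards [eventually_ge_atTop (1:ℝ)] with y hy
  simp only [dens, Function.comp, id]
  rw [intervalIntegral.integral_add hb.intervalIntegrable (stepq_int c d 0 y),
    stepq_integral c d y hy, Real.rpow_def_of_pos (by linarith), ← Real.exp_add]
  congr 1; ring

lemma prim_lim (f : ℝ → ℝ) (hf : Continuous f) (β E : ℝ) (hβ : 0 < β)
    (h : Tendsto (fun y => f y * y ^ (1 - β)) atTop (𝓝 E)) :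
    Tendsto (fun R => (∫ y in (0:ℝ)..R, f y) / R ^ β) atTop (𝓝 (E / β)) := by
  have hp : ∀ u v : ℝ, IntervalIntegrable (fun y : ℝ => y ^ (β - 1)) volume u v :=
    fun u v => intervalIntegral.intervalIntegrable_rpow' (by linarith)
  have hpi : ∀ u v : ℝ, ∫ y in u..v, y ^ (β - 1) = (v ^ β - u ^ β) / β := by
    intro u v
    rw [integral_rpow (Or.inl (by linarith))]; simp
  have hh : ∀ u v : ℝ, IntervalIntegrable (fun y => f y - E * y ^ (β - 1)) volume u v :=
    fun u v => (hf.intervalIntegrable u v).sub ((hp u v).const_mul E)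
  rw [Metric.tendsto_atTop] at h
  rw [Metric.tendsto_nhds]
  intro ε hε
  obtain ⟨M0, hM0⟩ := h (ε * β / 2) (by positivity)
  set M := max M0 1 with hM
  have hM1 : 1 ≤ M := le_max_right _ _
  set C := |∫ y in (0:ℝ)..M, (f y - E * y ^ (β - 1))| with hC
  have hlim : Tendsto (fun R : ℝ => C / R ^ β) atTop (𝓝 0) :=
    tendsto_const_nhds.div_atTop (tendsto_rpow_atTop hβ)
  filter_upwards [eventually_ge_atTop M, hlim.eventually (gt_mem_nhds (half_pos hε))] with R hR hCR
  have hR0 : 0 < R := by linarith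
  have hRb : 0 < R ^ β := Real.rpow_pos_of_pos hR0 _
  have e1 : (∫ y in (0:ℝ)..R, f y) / R ^ β - E / β
      = (∫ y in (0:ℝ)..R, (f y - E * y ^ (β - 1))) / R ^ β := by
    rw [intervalIntegral.integral_sub (hf.intervalIntegrable _ _) ((hp _ _).const_mul E),
      intervalIntegral.integral_const_mul, hpi, Real.zero_rpow hβ.ne']
    field_simp
    ring
  rw [Real.dist_eq, e1, ← intervalIntegral.integral_add_adjacent_intervals (hh 0 M) (hh M R),
    abs_div, abs_of_pos hRb]
  have e2 : |∫ y in M..R, (f y - E * y ^ (β - 1))| ≤ ∫ y in M..R, ε * β / 2 * y ^ (β - 1) := by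
    rw [← Real.norm_eq_abs]
    refine intervalIntegral.norm_integral_le_of_norm_le hR ?_ ((hp _ _).const_mul _)
    refine Eventually.of_forall fun y hy => ?_
    have hy0 : 0 < y := by linarith [hy.1]
    have hk := hM0 y ((le_max_left _ _).trans hy.1.le)
    rw [Real.dist_eq] at hk
    have hyb : 0 < y ^ (β - 1) := Real.rpow_pos_of_pos hy0 _
    have : f y - E * y ^ (β - 1) = (f y * y ^ (1 - β) - E) * y ^ (β - 1) := by
      rw [sub_mul, mul_assoc, ← Real.rpow_add hy0]; simp
    rw [this, norm_mul, Real.norm_eq_abs, Real.norm_eq_abs, abs_of_pos hyb]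
    gcongr
  rw [intervalIntegral.integral_const_mul, hpi] at e2
  have hMb : 0 < M ^ β := Real.rpow_pos_of_pos (by linarith) _
  have e3 : ε * β / 2 * ((R ^ β - M ^ β) / β) ≤ ε / 2 * R ^ β := by
    have : ε * β / 2 * ((R ^ β - M ^ β) / β) = ε / 2 * (R ^ β - M ^ β) := by field_simp
    rw [this]; gcongr; linarith
  rw [div_lt_iff₀ hRb] at hCR ⊢
  refine (abs_add_le _ _).trans_lt ?_
  linarith

lemma seq_lim (g : ℝ → ℝ) (β L x : ℝ) (hx : 0 < x)
    (h : Tendsto (fun R => g R / R ^ β) atTop (𝓝 L)) :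
    Tendsto (fun n : ℕ => g (n * x) / (n : ℝ) ^ β) atTop (𝓝 (L * x ^ β)) := by
  have h1 : Tendsto (fun n : ℕ => (n : ℝ) * x) atTop atTop :=
    tendsto_natCast_atTop_atTop.atTop_mul_const hx
  refine ((h.comp h1).mul_const (x ^ β)).congr' ?_
  filter_upwards [eventually_gt_atTop 0] with n hn
  have hn' : (0:ℝ) < n := by exact_mod_cast hn
  have hxb : 0 < x ^ β := Real.rpow_pos_of_pos hx _
  have hnb : 0 < (n:ℝ) ^ β := Real.rpow_pos_of_pos hn' _
  simp only [Function.comp]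
  rw [Real.mul_rpow hn'.le hx.le]
  field_simp

/-- Case A1(b)/A1(c)-type exit probabilities: if `c₋ < 1/2` and `c₋ < c₊`, then for `α > 0`
and `x ∈ (−α, α)`, the ratio `(φ(nx) − φ(−nα))/(φ(nα) − φ(−nα))` converges as `n → ∞` to
`1` if `x ≥ 0` and to `1 − (−x/α)^{1−2c₋}` if `x < 0`. -/
theorem stmt9 (atil : ℝ → ℝ) (hatil : MeasureTheory.Integrable atil)
    (cp cm : ℝ) (a : ℝ → ℝ)
    (ha : ∀ x : ℝ, a x = atil x + (if 1 < x then cp else if x < -1 then cm else 0) / x)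
    (φ : ℝ → ℝ)
    (hφ : ∀ x, φ x = ∫ y in (0:ℝ)..x, Real.exp (-2 * ∫ z in (0:ℝ)..y, a z))
    (hcm : cm < 1 / 2) (hcmp : cm < cp)
    (α : ℝ) (hα : 0 < α) (x : ℝ) (hx₁ : -α < x) (hx₂ : x < α) :
    Filter.Tendsto
      (fun n : ℕ => (φ (n * x) - φ (-(n * α))) / (φ (n * α) - φ (-(n * α))))
      Filter.atTop
      (nhds (if 0 ≤ x then 1 else 1 - (-x / α) ^ (1 - 2 * cm))) := by

  have hφ' : ∀ x, φ x = ∫ y in (0:ℝ)..x, dens atil cp cm y := by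
    intro x
    rw [hφ]
    simp only [dens, stepq, ha]
  have hβ : 0 < 1 - 2 * cm := by linarith
  set β := 1 - 2 * cm with hβd
  -- positive side
  have hpos : Tendsto (fun R => φ R / R ^ β) atTop (𝓝 0) := by
    obtain ⟨E, -, hE⟩ := dens_lim atil hatil cp cm 0
    have h0 := hE.mul (tendsto_rpow_neg_atTop (y := 2 * (cp - cm)) (by linarith))
    rw [mul_zero] at h0
    have := prim_lim (dens atil cp cm) (dens_cont _ hatil _ _) β 0 hβ (h0.congr' ?_)
    · simpa [hφ'] using this
    · filter_upwards [eventually_gt_atTop (0:ℝ)] with y hy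
      rw [mul_assoc, ← Real.rpow_add hy]
      congr 2; rw [hβd]; ring
  obtain ⟨V, hV, hneg⟩ : ∃ V : ℝ, 0 < V ∧ Tendsto (fun R => φ (-R) / R ^ β) atTop (𝓝 (-V)) := by
    have hb : Integrable (fun z => -atil (-z)) := hatil.comp_neg.neg
    obtain ⟨E, hE0, hE⟩ := dens_lim (fun z => -atil (-z)) hb cm cp 0
    refine ⟨E / β, by positivity, ?_⟩
    have e : 2 * cm = 1 - β := by rw [hβd]; ring
    rw [e] at hE
    have := (prim_lim _ (dens_cont _ hb cm cp) β E hβ hE).neg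
    refine this.congr fun R => ?_
    rw [hφ', ← neg_div]
    congr 1
    simp only [← dens_neg]
    rw [intervalIntegral.integral_comp_neg, neg_zero, ← intervalIntegral.integral_symm]
  have hP : ∀ t : ℝ, 0 ≤ t → Tendsto (fun n : ℕ => φ (n * t) / (n : ℝ) ^ β) atTop (𝓝 0) := by
    intro t ht
    rcases ht.eq_or_lt with rfl | ht
    · simp [hφ']
    · simpa using seq_lim φ β 0 t ht hpos
  have hN : ∀ t : ℝ, 0 < t →
      Tendsto (fun n : ℕ => φ (-(n * t)) / (n : ℝ) ^ β) atTop (𝓝 (-V * t ^ β)) :=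
    fun t ht => seq_lim (fun R => φ (-R)) β (-V) t ht hneg
  have hαb : 0 < α ^ β := Real.rpow_pos_of_pos hα _
  have hVα : 0 < V * α ^ β := by positivity
  have key : ∀ L : ℝ, Tendsto (fun n : ℕ => φ (n * x) / (n : ℝ) ^ β) atTop (𝓝 L) →
      Tendsto (fun n : ℕ => (φ (n * x) - φ (-(n * α))) / (φ (n * α) - φ (-(n * α)))) atTop
        (𝓝 ((L - -V * α ^ β) / (0 - -V * α ^ β))) := by
    intro L hL
    refine ((hL.sub (hN α hα)).div ((hP α hα.le).sub (hN α hα)) (by linarith)).congr' ?_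
    filter_upwards [eventually_gt_atTop 0] with n hn
    have hnb : 0 < (n:ℝ) ^ β := Real.rpow_pos_of_pos (by exact_mod_cast hn) _
    simp only [Pi.div_apply]
    rw [← sub_div, ← sub_div, div_div_div_cancel_right₀ hnb.ne']
  split_ifs with hx
  · have := key 0 (hP x hx)
    rwa [div_self (by linarith)] at this
  · have hx' : 0 < -x := by linarith
    have h1 := hN (-x) hx'
    simp only [mul_neg, neg_neg] at h1
    have := key _ h1
    convert this using 2
    rw [Real.div_rpow hx'.le hα.le]
    field_simp
    ring
end

section
/- Assume c₊ < 1/2 and c₊ < c₋. Fix α > 0 and x ∈ (−α, α). Then the ratio (φ(n x) − φ(−n α)) / (φ(n α) − φ(−n α)) converges as n → ∞ to (x/α)^{1−2c₊} if x > 0, and to 0 if x ≤ 0. -/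
open MeasureTheory Filter Topology Set

/-- Averaging lemma. -/
lemma avg_aux (f : ℝ → ℝ) (hf : Continuous f) (p L : ℝ) (hp : 0 < p)
    (h : Tendsto (fun y => f y / y ^ (p - 1)) atTop (𝓝 L)) :
    Tendsto (fun t => (∫ y in (0:ℝ)..t, f y) / t ^ p) atTop (𝓝 (L / p)) := by
  rw [Metric.tendsto_atTop] at h ⊢
  intro ε hε
  obtain ⟨T0, hT0⟩ := h (ε * p / 2) (by positivity)
  set T := max T0 1 with hT
  have hT1 : 1 ≤ T := le_max_right _ _
  set K := (∫ y in (0:ℝ)..T, f y) - L * (T ^ p / p) with hK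
  have hKt : Tendsto (fun t : ℝ => |K| / t ^ p) atTop (𝓝 0) :=
    (tendsto_rpow_atTop hp).const_div_atTop _
  obtain ⟨S, hS⟩ := (Metric.tendsto_atTop.1 hKt) (ε / 2) (by positivity)
  refine ⟨max S T, fun t ht => ?_⟩
  have htT : T ≤ t := le_trans (le_max_right _ _) ht
  have htS : S ≤ t := le_trans (le_max_left _ _) ht
  have ht0 : 0 < t := by linarith
  have htp : 0 < t ^ p := Real.rpow_pos_of_pos ht0 p
  have hTp : 0 < T ^ p := Real.rpow_pos_of_pos (by linarith) p
  have hint : IntervalIntegrable (fun y : ℝ => y ^ (p - 1)) volume T t :=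
    intervalIntegral.intervalIntegrable_rpow' (by linarith)
  have hpow : ∫ y in T..t, y ^ (p - 1) = (t ^ p - T ^ p) / p := by
    rw [integral_rpow (Or.inl (by linarith))]; simp
  have hbd : ‖∫ y in T..t, (f y - L * y ^ (p - 1))‖ ≤ ∫ y in T..t, (ε * p / 2) * y ^ (p - 1) := by
    apply intervalIntegral.norm_integral_le_of_norm_le htT
    · refine ae_of_all _ fun y hy => ?_
      have hy0 : 0 < y := by linarith [hy.1]
      have hq : 0 < y ^ (p - 1) := Real.rpow_pos_of_pos hy0 _
      have := hT0 y (le_trans (le_max_left _ _) hy.1.le)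
      rw [Real.dist_eq] at this
      have e : f y - L * y ^ (p - 1) = (f y / y ^ (p - 1) - L) * y ^ (p - 1) := by
        field_simp
      rw [e, norm_mul, Real.norm_eq_abs, Real.norm_eq_abs, abs_of_pos hq]
      gcongr
    · exact hint.const_mul _
  rw [intervalIntegral.integral_const_mul, hpow] at hbd
  have hsplit : (∫ y in (0:ℝ)..t, f y) - L * (t ^ p / p)
      = K + ∫ y in T..t, (f y - L * y ^ (p - 1)) := by
    rw [intervalIntegral.integral_sub (hf.intervalIntegrable _ _) (hint.const_mul _),
      intervalIntegral.integral_const_mul, hpow, hK,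
      ← intervalIntegral.integral_add_adjacent_intervals (hf.intervalIntegrable 0 T)
        (hf.intervalIntegrable T t)]
    ring
  have h1 := hS t htS
  rw [Real.dist_eq, sub_zero, abs_of_nonneg (by positivity), div_lt_iff₀ htp] at h1
  have e2 : (∫ y in (0:ℝ)..t, f y) / t ^ p - L / p
      = (K + ∫ y in T..t, (f y - L * y ^ (p - 1))) / t ^ p := by
    rw [← hsplit]; field_simp
  rw [Real.dist_eq, e2, abs_div, abs_of_pos htp, div_lt_iff₀ htp]
  have h3 : ε * p / 2 * ((t ^ p - T ^ p) / p) = ε / 2 * (t ^ p - T ^ p) := by field_simp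
  rw [h3, Real.norm_eq_abs] at hbd
  have h4 := abs_add_le K (∫ y in T..t, (f y - L * y ^ (p - 1)))
  nlinarith

lemma b_int (cp cm : ℝ) (u v : ℝ) : IntervalIntegrable
    (fun z : ℝ => (if 1 < z then cp else if z < -1 then cm else 0) / z) volume u v := by
  refine (intervalIntegrable_const (c := |cp| + |cm|)).mono_fun ?_ ?_
  · apply Measurable.aestronglyMeasurable
    refine Measurable.div ?_ measurable_id
    exact Measurable.ite measurableSet_Ioi measurable_const
      (Measurable.ite measurableSet_Iio measurable_const measurable_const)
  · refine ae_of_all _ fun z => ?_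
    have h1 := abs_nonneg cp
    have h2 := abs_nonneg cm
    simp only [Real.norm_eq_abs]
    rw [abs_of_nonneg (add_nonneg h1 h2), abs_div]
    split_ifs with h h'
    · have : 1 < |z| := lt_of_lt_of_le h (le_abs_self z)
      exact (div_le_self h1 this.le).trans (by linarith)
    · have : 1 < |z| := by have := neg_abs_le z; linarith
      exact (div_le_self h2 this.le).trans (by linarith)
    · simp; positivity

lemma b_pos (cp cm : ℝ) (y : ℝ) (hy : 1 ≤ y) :
    ∫ z in (0:ℝ)..y, (if 1 < z then cp else if z < -1 then cm else 0) / z = cp * Real.log y := by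
  rw [← intervalIntegral.integral_add_adjacent_intervals (b_int cp cm 0 1) (b_int cp cm 1 y)]
  have h1 : ∫ z in (0:ℝ)..1, (if 1 < z then cp else if z < -1 then cm else 0) / z = 0 := by
    apply intervalIntegral.integral_zero_ae
    refine ae_of_all _ fun z hz => ?_
    rw [uIoc_of_le zero_le_one] at hz
    rw [if_neg (by linarith [hz.2]), if_neg (by linarith [hz.1]), zero_div]
  have h2 : ∫ z in (1:ℝ)..y, (if 1 < z then cp else if z < -1 then cm else 0) / z
      = ∫ z in (1:ℝ)..y, cp * z⁻¹ := by
    apply intervalIntegral.integral_congr_ae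
    refine ae_of_all _ fun z hz => ?_
    rw [uIoc_of_le hy] at hz
    rw [if_pos hz.1, div_eq_mul_inv]
  rw [h1, h2, intervalIntegral.integral_const_mul,
    integral_inv_of_pos one_pos (by linarith), div_one, zero_add]

lemma b_neg (cp cm : ℝ) (y : ℝ) (hy : 1 ≤ y) :
    ∫ z in (0:ℝ)..(-y), (if 1 < z then cp else if z < -1 then cm else 0) / z
      = cm * Real.log y := by
  have h := intervalIntegral.integral_comp_neg (a := 0) (b := y)
    (fun z : ℝ => (if 1 < z then cp else if z < -1 then cm else 0) / z)
  rw [neg_zero] at h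
  rw [intervalIntegral.integral_symm, ← h, ← b_pos cm cp y hy,
    ← intervalIntegral.integral_neg]
  apply intervalIntegral.integral_congr_ae
  refine ae_of_all _ fun z hz => ?_
  rw [uIoc_of_le (by linarith)] at hz
  have hz0 := hz.1
  by_cases h1 : 1 < z
  · rw [if_neg (by linarith), if_pos (by linarith), if_pos h1, div_neg, neg_neg]
  · rw [if_neg (by linarith), if_neg (by linarith), if_neg h1, if_neg (by linarith)]; simp


/-- Case A2-type exit probabilities: if `c₊ < 1/2` and `c₊ < c₋`, then for `α > 0` and
`x ∈ (−α, α)`, the ratio `(φ(nx) − φ(−nα))/(φ(nα) − φ(−nα))` converges as `n → ∞` to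
`(x/α)^{1−2c₊}` if `x > 0` and to `0` if `x ≤ 0`. -/
theorem stmt10 (atil : ℝ → ℝ) (hatil : MeasureTheory.Integrable atil)
    (cp cm : ℝ) (a : ℝ → ℝ)
    (ha : ∀ x : ℝ, a x = atil x + (if 1 < x then cp else if x < -1 then cm else 0) / x)
    (φ : ℝ → ℝ)
    (hφ : ∀ x, φ x = ∫ y in (0:ℝ)..x, Real.exp (-2 * ∫ z in (0:ℝ)..y, a z))
    (hcp : cp < 1 / 2) (hcpm : cp < cm)
    (α : ℝ) (hα : 0 < α) (x : ℝ) (hx₁ : -α < x) (hx₂ : x < α) :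
    Filter.Tendsto
      (fun n : ℕ => (φ (n * x) - φ (-(n * α))) / (φ (n * α) - φ (-(n * α))))
      Filter.atTop
      (nhds (if 0 < x then (x / α) ^ (1 - 2 * cp) else 0)) := by
  set p := 1 - 2 * cp with hp_def
  have hp : 0 < p := by rw [hp_def]; linarith
  have haint : ∀ u v : ℝ, IntervalIntegrable a volume u v := by
    intro u v
    have : a = fun z => atil z + (if 1 < z then cp else if z < -1 then cm else 0) / z := funext ha
    rw [this]
    exact hatil.intervalIntegrable.add (b_int cp cm u v)
  set g : ℝ → ℝ := fun y => Real.exp (-2 * ∫ z in (0:ℝ)..y, a z) with hg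
  have hgc : Continuous g :=
    Real.continuous_exp.comp
      (continuous_const.mul (intervalIntegral.continuous_primitive haint 0))
  have hsum : ∀ y : ℝ, ∫ z in (0:ℝ)..y, a z = (∫ z in (0:ℝ)..y, atil z) +
      ∫ z in (0:ℝ)..y, (if 1 < z then cp else if z < -1 then cm else 0) / z := by
    intro y
    rw [← intervalIntegral.integral_add hatil.intervalIntegrable (b_int cp cm 0 y)]
    exact intervalIntegral.integral_congr fun z _ => ha z
  have hA : Tendsto (fun y : ℝ => ∫ z in (0:ℝ)..y, atil z) atTop (𝓝 (∫ z in Ioi (0:ℝ), atil z)) :=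
    intervalIntegral_tendsto_integral_Ioi 0 hatil.integrableOn tendsto_id
  have hB : Tendsto (fun y : ℝ => ∫ z in (0:ℝ)..(-y), atil z) atTop
      (𝓝 (-∫ z in Iic (0:ℝ), atil z)) := by
    have := intervalIntegral_tendsto_integral_Iic (0:ℝ) (f := atil) (μ := volume)
      hatil.integrableOn tendsto_neg_atTop_atBot
    refine this.neg.congr fun y => ?_
    rw [intervalIntegral.integral_symm 0 (-y)]
    simp
  set L := Real.exp (-2 * ∫ z in Ioi (0:ℝ), atil z) with hL
  have hL0 : 0 < L := Real.exp_pos _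
  have hg1 : Tendsto (fun y => g y / y ^ (p - 1)) atTop (𝓝 L) := by
    refine ((Real.continuous_exp.tendsto _).comp (hA.const_mul (-2))).congr' ?_
    filter_upwards [eventually_ge_atTop 1] with y hy
    have hy0 : 0 < y := by linarith
    simp only [hg, Function.comp]
    rw [hsum, b_pos cp cm y hy, Real.rpow_def_of_pos hy0, ← Real.exp_sub, hp_def]
    congr 1; ring
  have hg2 : Tendsto (fun y => g (-y) / y ^ (p - 1)) atTop (𝓝 0) := by
    have h0 := ((Real.continuous_exp.tendsto _).comp (hB.const_mul (-2))).mul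
      (tendsto_rpow_neg_atTop (y := 2 * (cm - cp)) (by linarith))
    rw [mul_zero] at h0
    refine h0.congr' ?_
    filter_upwards [eventually_ge_atTop 1] with y hy
    have hy0 : 0 < y := by linarith
    simp only [hg, Function.comp]
    rw [hsum, b_neg cp cm y hy, Real.rpow_def_of_pos hy0, Real.rpow_def_of_pos hy0,
      ← Real.exp_sub, ← Real.exp_add, hp_def]
    congr 1; ring
  have hP := avg_aux g hgc p L hp hg1
  have hN := avg_aux (fun y => g (-y)) (hgc.comp continuous_neg) p 0 hp hg2
  rw [zero_div] at hN
  have hφP : ∀ t, φ t = ∫ y in (0:ℝ)..t, g y := hφ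
  have hφN : ∀ t, φ (-t) = -∫ y in (0:ℝ)..t, g (-y) := by
    intro t
    rw [hφP, intervalIntegral.integral_comp_neg, neg_zero, intervalIntegral.integral_symm]
  have hscale : ∀ (F : ℝ → ℝ) (l s : ℝ), 0 < s → Tendsto (fun t => F t / t ^ p) atTop (𝓝 l) →
      Tendsto (fun n : ℕ => F (n * s) / (n : ℝ) ^ p) atTop (𝓝 (l * s ^ p)) := by
    intro F l s hs hF
    have h1 : Tendsto (fun n : ℕ => (n : ℝ) * s) atTop atTop :=
      tendsto_natCast_atTop_atTop.atTop_mul_const hs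
    refine ((hF.comp h1).mul_const (s ^ p)).congr fun n => ?_
    have hsp : 0 < s ^ p := Real.rpow_pos_of_pos hs p
    simp only [Function.comp]
    rw [Real.mul_rpow (Nat.cast_nonneg n) hs.le, ← div_div, div_mul_cancel₀ _ hsp.ne']
  have hPs : ∀ s : ℝ, 0 < s →
      Tendsto (fun n : ℕ => φ (n * s) / (n : ℝ) ^ p) atTop (𝓝 (L / p * s ^ p)) := by
    intro s hs
    refine hscale φ _ s hs (hP.congr fun t => ?_)
    rw [hφP]
  have hNs : ∀ s : ℝ, 0 < s →
      Tendsto (fun n : ℕ => φ (-(n * s)) / (n : ℝ) ^ p) atTop (𝓝 0) := by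
    intro s hs
    have hN' := hN.neg
    rw [neg_zero] at hN'
    have := hscale (fun t => φ (-t)) 0 s hs (hN'.congr fun t => ?_)
    · simpa using this
    · rw [hφN, neg_div]
  have hαp : 0 < α ^ p := Real.rpow_pos_of_pos hα p
  have hnum : Tendsto (fun n : ℕ => φ (n * x) / (n : ℝ) ^ p) atTop
      (𝓝 (if 0 < x then L / p * x ^ p else 0)) := by
    rcases lt_trichotomy x 0 with h | h | h
    · rw [if_neg (by linarith)]
      refine (hNs (-x) (by linarith)).congr fun n => ?_
      rw [mul_neg, neg_neg]
    · rw [if_neg (by linarith)]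
      simp [h, hφP]
    · rw [if_pos h]
      exact hPs x h
  have hfin := (hnum.sub (hNs α hα)).div ((hPs α hα).sub (hNs α hα))
    (by rw [sub_zero]; positivity)
  have hval : ((if 0 < x then L / p * x ^ p else 0) - 0) / (L / p * α ^ p - 0)
      = if 0 < x then (x / α) ^ p else 0 := by
    split_ifs with h
    · rw [Real.div_rpow h.le hα.le]; rw [sub_zero, sub_zero, mul_div_mul_left _ _ (by positivity)]
    · simp
  rw [hval] at hfin
  refine hfin.congr' ?_
  filter_upwards [eventually_gt_atTop 0] with n hn
  have hn' : 0 < (n : ℝ) ^ p := Real.rpow_pos_of_pos (Nat.cast_pos.2 hn) p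
  simp only [Pi.div_apply]
  rw [← sub_div, ← sub_div, div_div_div_cancel_right₀ hn'.ne']
end

section
/- Assume c₊ = c₋ = c < 1/2. Fix α > 0 and x ∈ (−α, α), and set p = A(−∞) / (A(+∞) + A(−∞)). Then the ratio (φ(n x) − φ(−n α)) / (φ(n α) − φ(−n α)) converges as n → ∞ to p + (1 − p)·(x/α)^{1−2c} if x ≥ 0, and to p·(1 − (−x/α)^{1−2c}) if x < 0. Moreover p = (1 + γ)/2, where γ = tanh(∫_{−∞}^{+∞} ã(z) dz). -/
open MeasureTheory Filter Topology Set

/-- Integrated asymptotics: if `g y / y^(k-1) → L` then `(∫₀ˣ g) / x^k → L / k`. -/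
lemma key_asymp (g : ℝ → ℝ) (hg : Continuous g) (k L : ℝ) (hk : 0 < k)
    (h : Tendsto (fun y => g y / y ^ (k - 1)) atTop (𝓝 L)) :
    Tendsto (fun X : ℝ => (∫ y in (0:ℝ)..X, g y) / X ^ k) atTop (𝓝 (L / k)) := by
  rw [Metric.tendsto_atTop] at h ⊢
  intro ε hε
  obtain ⟨N, hN⟩ := h (ε * k / 2) (by positivity)
  set M := max N 1 with hM
  have hM1 : 1 ≤ M := le_max_right _ _
  have hM0 : 0 < M := by linarith
  set C := |(∫ y in (0:ℝ)..M, g y) - L / k * M ^ k| with hC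
  have hlim : Tendsto (fun X : ℝ => X ^ k) atTop atTop := tendsto_rpow_atTop hk
  obtain ⟨N2, hN2⟩ := (hlim.eventually_gt_atTop (C / (ε / 2))).exists_forall_of_atTop
  refine ⟨max M N2, fun X hX => ?_⟩
  have hXM : M ≤ X := le_trans (le_max_left _ _) hX
  have hX0 : 0 < X := by linarith
  have hXk : 0 < X ^ k := Real.rpow_pos_of_pos hX0 k
  have hC2 : C < ε / 2 * X ^ k := by
    have := hN2 X (le_trans (le_max_right _ _) hX)
    rwa [div_lt_iff₀ (by positivity), mul_comm] at this
  have hI : ∀ a b : ℝ, IntervalIntegrable (fun y : ℝ => y ^ (k - 1)) volume a b := fun a b =>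
    intervalIntegral.intervalIntegrable_rpow' (by linarith)
  have hgi : ∀ a b : ℝ, IntervalIntegrable g volume a b := fun a b => hg.intervalIntegrable a b
  have hpow : ∫ y in M..X, y ^ (k - 1) = (X ^ k - M ^ k) / k := by
    rw [integral_rpow (Or.inl (by linarith))]; simp
  have hb : ‖∫ y in M..X, (g y - L * y ^ (k - 1))‖ ≤ ∫ y in M..X, (ε * k / 2) * y ^ (k - 1) := by
    apply intervalIntegral.norm_integral_le_of_norm_le hXM
    · refine Eventually.of_forall fun y hy => ?_
      have hy0 : 0 < y := by linarith [hy.1]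
      have hyp : 0 < y ^ (k - 1) := Real.rpow_pos_of_pos hy0 _
      have := hN y (le_trans (le_max_left _ _) hy.1.le)
      rw [Real.dist_eq] at this
      rw [Real.norm_eq_abs]
      have e : g y - L * y ^ (k - 1) = (g y / y ^ (k - 1) - L) * y ^ (k - 1) := by
        field_simp
      rw [e, abs_mul, abs_of_pos hyp]
      gcongr
    · exact (hI _ _).const_mul _
  rw [intervalIntegral.integral_sub (hgi _ _) ((hI _ _).const_mul _),
    intervalIntegral.integral_const_mul, intervalIntegral.integral_const_mul, hpow,
    Real.norm_eq_abs] at hb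
  have hsplit := intervalIntegral.integral_add_adjacent_intervals (hgi 0 M) (hgi M X)
  have hMk : 0 < M ^ k := Real.rpow_pos_of_pos hM0 k
  have e1 : (ε * k / 2) * ((X ^ k - M ^ k) / k) = ε / 2 * (X ^ k - M ^ k) := by
    field_simp
  have e2 : L * ((X ^ k - M ^ k) / k) = L / k * X ^ k - L / k * M ^ k := by ring
  rw [e1, e2] at hb
  rw [Real.dist_eq]
  have e3 : (∫ y in (0:ℝ)..X, g y) / X ^ k - L / k
      = ((∫ y in (0:ℝ)..X, g y) - L / k * X ^ k) / X ^ k := by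
    field_simp
  rw [e3, abs_div, abs_of_pos hXk, div_lt_iff₀ hXk, ← hsplit]
  have h3 := abs_add_le ((∫ y in (0:ℝ)..M, g y) - L / k * M ^ k)
    ((∫ y in M..X, g y) - (L / k * X ^ k - L / k * M ^ k))
  have e4 : (∫ y in (0:ℝ)..M, g y) + (∫ y in M..X, g y) - L / k * X ^ k
    = ((∫ y in (0:ℝ)..M, g y) - L / k * M ^ k) +
    ((∫ y in M..X, g y) - (L / k * X ^ k - L / k * M ^ k)) := by ring
  rw [e4]
  have : 0 < ε / 2 * M ^ k := by positivity
  have h5 : ε / 2 * (X ^ k - M ^ k) = ε / 2 * X ^ k - ε / 2 * M ^ k := by ring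
  linarith

lemma side_asymp (atil : ℝ → ℝ) (hatil : Integrable atil) (c : ℝ) (hc : c < 1 / 2)
    (a : ℝ → ℝ)
    (ha : ∀ x : ℝ, a x = atil x + (if 1 < x then c else if x < -1 then c else 0) / x) :
    Tendsto (fun X : ℝ => (∫ y in (0:ℝ)..X, Real.exp (-2 * ∫ z in (0:ℝ)..y, a z)) /
      X ^ (1 - 2 * c)) atTop
      (𝓝 (Real.exp (-2 * ∫ z in Ioi (0:ℝ), atil z) / (1 - 2 * c))) := by
  set b : ℝ → ℝ := fun x => (if 1 < x then c else if x < -1 then c else 0) / x with hb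
  have hab : a = fun x => atil x + b x := funext ha
  have hbm : Measurable b := by
    refine Measurable.div ?_ measurable_id
    refine Measurable.ite measurableSet_Ioi measurable_const ?_
    exact Measurable.ite measurableSet_Iio measurable_const measurable_const
  have hbb : ∀ x, ‖b x‖ ≤ |c| := by
    intro x
    simp only [hb, Real.norm_eq_abs, abs_div]
    split_ifs with h1 h2
    · exact div_le_self (abs_nonneg _) (h1.le.trans (le_abs_self _))
    · exact div_le_self (abs_nonneg _) (by rw [abs_of_neg (by linarith)]; linarith)
    · simp
  have hbi : ∀ u v : ℝ, IntervalIntegrable b volume u v := fun u v =>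
    (intervalIntegrable_const (c := |c|)).mono_fun hbm.aestronglyMeasurable
      (Eventually.of_forall fun x => by simpa using hbb x)
  have hti : ∀ u v : ℝ, IntervalIntegrable atil volume u v := fun u v =>
    hatil.intervalIntegrable
  have hai : ∀ u v : ℝ, IntervalIntegrable a volume u v := fun u v => by
    rw [hab]; exact (hti u v).add (hbi u v)
  have hlog : ∀ y : ℝ, 1 ≤ y → ∫ z in (0:ℝ)..y, b z = c * Real.log y := by
    intro y hy
    rw [← intervalIntegral.integral_add_adjacent_intervals (hbi 0 1) (hbi 1 y)]
    have h0 : ∫ z in (0:ℝ)..1, b z = 0 := by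
      rw [intervalIntegral.integral_congr (g := fun _ => (0:ℝ))]
      · simp
      · intro z hz
        rw [uIcc_of_le zero_le_one] at hz
        have h1 : ¬ (1 < z) := not_lt.2 hz.2
        have h2 : ¬ (z < -1) := by linarith [hz.1]
        simp [hb, h1, h2]
    have h1 : ∫ z in (1:ℝ)..y, b z = ∫ z in (1:ℝ)..y, c * z⁻¹ := by
      apply intervalIntegral.integral_congr_ae
      refine Eventually.of_forall fun z hz => ?_
      rw [uIoc_of_le hy] at hz
      simp [hb, hz.1, div_eq_mul_inv]
    rw [h0, h1, intervalIntegral.integral_const_mul, integral_inv_of_pos one_pos (by linarith)]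
    simp
  apply key_asymp
  · have := intervalIntegral.continuous_primitive hai 0
    fun_prop
  · linarith
  · have h1 : Tendsto (fun y : ℝ => ∫ z in (0:ℝ)..y, atil z) atTop
        (𝓝 (∫ z in Ioi (0:ℝ), atil z)) :=
      intervalIntegral_tendsto_integral_Ioi 0 hatil.integrableOn tendsto_id
    have h2 : Tendsto (fun y : ℝ => Real.exp (-2 * ∫ z in (0:ℝ)..y, atil z)) atTop
        (𝓝 (Real.exp (-2 * ∫ z in Ioi (0:ℝ), atil z))) :=
      (Real.continuous_exp.tendsto _).comp (h1.const_mul _)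
    refine h2.congr' ?_
    filter_upwards [eventually_ge_atTop 1] with y hy
    have hy0 : 0 < y := by linarith
    rw [eq_div_iff (Real.rpow_pos_of_pos hy0 _).ne', Real.rpow_def_of_pos hy0, ← Real.exp_add,
      hab, intervalIntegral.integral_add (hti _ _) (hbi _ _), hlog y hy]
    congr 1
    ring

/-- Case A5 (skew Bessel) exit probabilities: if `c₊ = c₋ = c < 1/2`, then for `α > 0`,
`x ∈ (−α, α)` and `p = A(−∞)/(A(+∞) + A(−∞))`, the ratio
`(φ(nx) − φ(−nα))/(φ(nα) − φ(−nα))` converges as `n → ∞` to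
`p + (1−p)(x/α)^{1−2c}` if `x ≥ 0` and to `p(1 − (−x/α)^{1−2c})` if `x < 0`;
moreover `p = (1 + γ)/2` with `γ = tanh(∫_ℝ ã)`. -/
theorem stmt11 (atil : ℝ → ℝ) (hatil : MeasureTheory.Integrable atil)
    (cp cm c : ℝ) (hcp : cp = c) (hcm : cm = c) (hc : c < 1 / 2)
    (a : ℝ → ℝ)
    (ha : ∀ x : ℝ, a x = atil x + (if 1 < x then cp else if x < -1 then cm else 0) / x)
    (φ : ℝ → ℝ)
    (hφ : ∀ x, φ x = ∫ y in (0:ℝ)..x, Real.exp (-2 * ∫ z in (0:ℝ)..y, a z))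
    (Ap Am p : ℝ)
    (hAp : Ap = Real.exp (-2 * ∫ z in Set.Ioi (0:ℝ), atil z))
    (hAm : Am = Real.exp (2 * ∫ z in Set.Iic (0:ℝ), atil z))
    (hp : p = Am / (Ap + Am))
    (α : ℝ) (hα : 0 < α) (x : ℝ) (hx₁ : -α < x) (hx₂ : x < α) :
    Filter.Tendsto
      (fun n : ℕ => (φ (n * x) - φ (-(n * α))) / (φ (n * α) - φ (-(n * α))))
      Filter.atTop
      (nhds (if 0 ≤ x then p + (1 - p) * (x / α) ^ (1 - 2 * c)
             else p * (1 - (-x / α) ^ (1 - 2 * c)))) ∧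
    p = (1 + Real.tanh (∫ z, atil z)) / 2 := by
  subst hcp
  subst hcm
  have hk : 0 < 1 - 2 * cm := by linarith
  have hApp : 0 < Ap := hAp ▸ Real.exp_pos _
  have hAmp : 0 < Am := hAm ▸ Real.exp_pos _
  constructor
  · have hP : Tendsto (fun X : ℝ => φ X / X ^ (1 - 2 * cm)) atTop (𝓝 (Ap / (1 - 2 * cm))) := by
      simp only [hφ, hAp]
      exact side_asymp atil hatil cm hc a ha
    have hN : Tendsto (fun X : ℝ => φ (-X) / X ^ (1 - 2 * cm)) atTop
        (𝓝 (-(Am / (1 - 2 * cm)))) := by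
      have h := (side_asymp (fun z => - atil (-z)) hatil.comp_neg.neg cm hc (fun z => - a (-z))
        (by
          intro z
          rw [ha]
          by_cases h1 : 1 < z
          · have : ¬ (1 < -z) := by linarith
            simp [h1, this, div_neg, add_comm]
          · by_cases h2 : z < -1
            · have : 1 < -z := by linarith
              simp [h1, h2, this, div_neg, add_comm]
            · have h3 : ¬ (1 < -z) := by linarith
              have h4 : ¬ (-z < -1) := by linarith
              simp only [h1, h2, h3, h4, if_false]
              simp)).neg
      have e1 : (∫ z in Ioi (0:ℝ), - atil (-z)) = - ∫ z in Iic (0:ℝ), atil z := by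
        rw [integral_neg, integral_comp_neg_Ioi]
        simp
      rw [e1] at h
      have e2 : -2 * -(∫ z in Iic (0:ℝ), atil z) = 2 * ∫ z in Iic (0:ℝ), atil z := by ring
      rw [e2, ← hAm] at h
      refine h.congr fun X => ?_
      rw [hφ, ← neg_div]
      congr 1
      have e3 : ∀ y : ℝ, ∫ z in (0:ℝ)..y, - a (-z) = ∫ z in (0:ℝ)..(-y), a z := by
        intro y
        rw [intervalIntegral.integral_neg, intervalIntegral.integral_comp_neg (fun z => a z),
          neg_zero, ← intervalIntegral.integral_symm]
      simp only [e3]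
      rw [intervalIntegral.integral_comp_neg
        (fun y => Real.exp (-2 * ∫ z in (0:ℝ)..y, a z)), neg_zero,
        ← intervalIntegral.integral_symm]
    -- scaled versions
    have hscale : ∀ (f : ℝ → ℝ) (l t : ℝ), 0 < t →
        Tendsto (fun X : ℝ => f X / X ^ (1 - 2 * cm)) atTop (𝓝 l) →
        Tendsto (fun n : ℕ => f (n * t) / (n : ℝ) ^ (1 - 2 * cm)) atTop
          (𝓝 (l * t ^ (1 - 2 * cm))) := by
      intro f l t ht h
      have h1 : Tendsto (fun n : ℕ => (n : ℝ) * t) atTop atTop :=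
        tendsto_natCast_atTop_atTop.atTop_mul_const ht
      refine ((h.comp h1).mul_const (t ^ (1 - 2 * cm))).congr' ?_
      filter_upwards [eventually_gt_atTop 0] with n hn
      have hn' : (0:ℝ) < n := by exact_mod_cast hn
      have := (Real.rpow_pos_of_pos hn' (1 - 2 * cm)).ne'
      have := (Real.rpow_pos_of_pos ht (1 - 2 * cm)).ne'
      simp only [Function.comp]
      rw [Real.mul_rpow hn'.le ht.le]
      field_simp
    have hPα := hscale φ _ α hα hP
    have hNα := hscale (fun X => φ (-X)) _ α hα hN
    have hαk : 0 < α ^ (1 - 2 * cm) := Real.rpow_pos_of_pos hα _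
    have hφ0 : φ 0 = 0 := by simp [hφ]
    have hx : Tendsto (fun n : ℕ => φ (n * x) / (n : ℝ) ^ (1 - 2 * cm)) atTop
        (𝓝 (if 0 ≤ x then Ap / (1 - 2 * cm) * x ^ (1 - 2 * cm)
          else -(Am / (1 - 2 * cm)) * (-x) ^ (1 - 2 * cm))) := by
      split_ifs with h
      · rcases h.eq_or_lt with h | h
        · subst h
          simp [hφ0, Real.zero_rpow hk.ne']
        · exact hscale φ _ x h hP
      · have := hscale (fun X => φ (-X)) _ (-x) (by linarith) hN
        simpa using this
    have hD : Ap / (1 - 2 * cm) * α ^ (1 - 2 * cm) - -(Am / (1 - 2 * cm)) * α ^ (1 - 2 * cm) ≠ 0 := by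
      have : 0 < Ap / (1 - 2 * cm) * α ^ (1 - 2 * cm) := by positivity
      have : 0 < Am / (1 - 2 * cm) * α ^ (1 - 2 * cm) := by positivity
      linarith
    have hfin := (hx.sub hNα).div (hPα.sub hNα) hD
    have hval : (if 0 ≤ x then p + (1 - p) * (x / α) ^ (1 - 2 * cm)
             else p * (1 - (-x / α) ^ (1 - 2 * cm))) =
        ((if 0 ≤ x then Ap / (1 - 2 * cm) * x ^ (1 - 2 * cm)
          else -(Am / (1 - 2 * cm)) * (-x) ^ (1 - 2 * cm)) -
          -(Am / (1 - 2 * cm)) * α ^ (1 - 2 * cm)) /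
        (Ap / (1 - 2 * cm) * α ^ (1 - 2 * cm) - -(Am / (1 - 2 * cm)) * α ^ (1 - 2 * cm)) := by
      have hs : Ap + Am ≠ 0 := by positivity
      rw [eq_div_iff hD, hp]
      split_ifs with h
      · rw [Real.div_rpow h hα.le]
        generalize 1 - 2 * cm = k at *
        field_simp
        ring
      · rw [Real.div_rpow (by linarith) hα.le]
        generalize 1 - 2 * cm = k at *
        field_simp
        ring
    rw [hval]
    refine hfin.congr' ?_
    filter_upwards [eventually_gt_atTop 0] with n hn
    have hn' : (0:ℝ) < n := by exact_mod_cast hn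
    have := (Real.rpow_pos_of_pos hn' (1 - 2 * cm)).ne'
    simp only [Pi.div_apply]
    rw [← sub_div, ← sub_div, div_div_div_cancel_right₀ this]
  · have hsum : (∫ z, atil z) = (∫ z in Iic (0:ℝ), atil z) + ∫ z in Ioi (0:ℝ), atil z :=
      (intervalIntegral.integral_Iic_add_Ioi hatil.integrableOn hatil.integrableOn).symm
    rw [hsum, hp, hAp, hAm, Real.tanh_eq_sinh_div_cosh, Real.sinh_eq, Real.cosh_eq]
    generalize (∫ z in Iic (0:ℝ), atil z) = u
    generalize (∫ z in Ioi (0:ℝ), atil z) = v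
    have e1 : Real.exp (2 * u) = Real.exp u * Real.exp u := by rw [← Real.exp_add]; ring_nf
    have e2 : Real.exp (-2 * v) = (Real.exp v * Real.exp v)⁻¹ := by
      rw [← Real.exp_add, ← Real.exp_neg]; ring_nf
    rw [e1, e2, Real.exp_neg, Real.exp_add]
    have := Real.exp_pos u
    have := Real.exp_pos v
    field_simp
    ring
end

section
/- Assume c₊ > 1/2 and c₋ > 1/2. Then the integrals I₋ = ∫₀^{∞} A(−y) · max(y,1)^{−2c₋} dy and I₊ = ∫₀^{∞} A(y) · max(y,1)^{−2c₊} dy are both finite, and for every α > 0, the ratio (−φ(−n α)) / (φ(n α) − φ(−n α)) converges as n → ∞ to p = I₋ / (I₋ + I₊), which lies in (0, 1). -/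
open MeasureTheory Set Filter Topology

lemma aux_congr {f g : ℝ → ℝ} {a b : ℝ} (h : ∀ z ∈ Set.uIoc a b, f z = g z) :
    ∫ z in a..b, f z = ∫ z in a..b, g z :=
  intervalIntegral.integral_congr_ae (Eventually.of_forall h)

lemma aux_step (c y : ℝ) (hy : 0 ≤ y) :
    IntervalIntegrable (fun z : ℝ => (if 1 < z then c else 0) / z) volume 0 y ∧
    ∫ z in (0:ℝ)..y, (if 1 < z then c else 0) / z = c * Real.log (max y 1) := by
  have key : ∀ t : ℝ, 0 ≤ t → t ≤ 1 →
      IntervalIntegrable (fun z : ℝ => (if 1 < z then c else 0) / z) volume 0 t ∧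
      ∫ z in (0:ℝ)..t, (if 1 < z then c else 0) / z = 0 := by
    intro t ht0 ht1
    have he : ∀ z ∈ Set.uIoc 0 t, (0:ℝ) = (if 1 < z then c else 0) / z := by
      intro z hz
      rw [Set.uIoc_of_le ht0] at hz
      rw [if_neg (by linarith [hz.2])]; simp
    constructor
    · exact (intervalIntegrable_const (c := (0:ℝ))).congr he
    · rw [← aux_congr he]; simp
  rcases le_total y 1 with h | h
  · obtain ⟨h1, h2⟩ := key y hy h
    refine ⟨h1, ?_⟩
    rw [h2, max_eq_right h]; simp
  · obtain ⟨h1, h2⟩ := key 1 zero_le_one le_rfl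
    have he : ∀ z ∈ Set.uIoc 1 y, c * z⁻¹ = (if 1 < z then c else 0) / z := by
      intro z hz
      rw [Set.uIoc_of_le h] at hz
      rw [if_pos hz.1]; rfl
    have h0 : (0:ℝ) ∉ Set.uIcc 1 y := by
      rw [Set.uIcc_of_le h]; intro hh; linarith [hh.1]
    have h3 : IntervalIntegrable (fun z : ℝ => (if 1 < z then c else 0) / z) volume 1 y :=
      ((intervalIntegrable_inv_iff.2 (Or.inr h0)).const_mul c).congr he
    refine ⟨h1.trans h3, ?_⟩
    rw [← intervalIntegral.integral_add_adjacent_intervals h1 h3, h2,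
      ← aux_congr he, intervalIntegral.integral_const_mul,
      integral_inv h0, max_eq_left h]
    simp

lemma aux_key (f : ℝ → ℝ) (hf : Integrable f) (c : ℝ) (hc : 1 / 2 < c) (b : ℝ → ℝ)
    (hb : ∀ z, 0 < z → b z = f z + (if 1 < z then c else 0) / z) (g : ℝ → ℝ)
    (hg : ∀ y, g y = Real.exp (-2 * ∫ z in (0:ℝ)..y, f z) * max y 1 ^ (-(2 * c))) :
    IntegrableOn g (Ioi 0) ∧ 0 < ∫ y in Ioi (0:ℝ), g y ∧
    Tendsto (fun x : ℝ => ∫ y in (0:ℝ)..x, Real.exp (-2 * ∫ z in (0:ℝ)..y, b z)) atTop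
      (𝓝 (∫ y in Ioi (0:ℝ), g y)) := by
  have hcont : Continuous g := by
    rw [funext hg]
    have h1 : Continuous fun y => ∫ z in (0:ℝ)..y, f z :=
      intervalIntegral.continuous_primitive (fun _ _ => hf.intervalIntegrable) 0
    have h2 : Continuous fun y : ℝ => max y 1 ^ (-(2 * c)) :=
      (continuous_id.max continuous_const).rpow_const
        (fun y => Or.inl (by have := le_max_right y 1; simp only [id]; positivity))
    exact (Real.continuous_exp.comp (continuous_const.mul h1)).mul h2
  have hpos : ∀ y, 0 < g y := by
    intro y; rw [hg]
    have : 0 < max y 1 := lt_of_lt_of_le one_pos (le_max_right _ _)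
    positivity
  have hB : ∀ y, Real.exp (-2 * ∫ z in (0:ℝ)..y, f z) ≤ Real.exp (2 * ∫ z, ‖f z‖) := by
    intro y
    apply Real.exp_le_exp.2
    have h1 : ‖∫ z in (0:ℝ)..y, f z‖ ≤ ∫ z, ‖f z‖ :=
      (intervalIntegral.norm_integral_le_integral_norm_uIoc).trans
        (setIntegral_le_integral hf.norm (Eventually.of_forall fun _ => norm_nonneg _))
    rw [Real.norm_eq_abs] at h1
    linarith [(abs_le.1 h1).1]
  have hint : IntegrableOn g (Ioi 0) := by
    rw [← Ioc_union_Ioi_eq_Ioi (zero_le_one : (0:ℝ) ≤ 1)]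
    refine IntegrableOn.union ?_ ?_
    · exact (hcont.integrableOn_Icc (a := 0) (b := 1)).mono_set Ioc_subset_Icc_self
    · have h1 : IntegrableOn (fun y : ℝ => Real.exp (2 * ∫ z, ‖f z‖) * y ^ (-(2 * c))) (Ioi 1) :=
        (integrableOn_Ioi_rpow_of_lt (by linarith) one_pos).const_mul _
      refine Integrable.mono' h1 hcont.aestronglyMeasurable ?_
      refine (ae_restrict_iff' measurableSet_Ioi).2 (Eventually.of_forall fun y hy => ?_)
      rw [Real.norm_eq_abs, abs_of_pos (hpos y), hg, max_eq_left (le_of_lt hy)]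
      have hy' : (0:ℝ) < y := one_pos.trans hy
      exact mul_le_mul_of_nonneg_right (hB y) (by positivity)
  refine ⟨hint, ?_, ?_⟩
  · rw [setIntegral_pos_iff_support_of_nonneg_ae
      (Eventually.of_forall fun y => (hpos y).le) hint]
    have : Function.support g = univ := by
      ext y; simp [(hpos y).ne']
    rw [this]; simp
  · refine (intervalIntegral_tendsto_integral_Ioi 0 hint tendsto_id).congr' ?_
    filter_upwards [eventually_ge_atTop 0] with x hx
    apply intervalIntegral.integral_congr
    intro y hy
    simp only [id] at hy
    rw [uIcc_of_le hx] at hy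
    have hy0 := hy.1
    obtain ⟨h1, h2⟩ := aux_step c y hy0
    have h3 : ∫ z in (0:ℝ)..y, b z = (∫ z in (0:ℝ)..y, f z) + c * Real.log (max y 1) := by
      rw [← h2, ← intervalIntegral.integral_add hf.intervalIntegrable h1]
      apply aux_congr
      intro z hz
      rw [uIoc_of_le hy0] at hz
      exact hb z hz.1
    have hm : 0 < max y 1 := lt_of_lt_of_le one_pos (le_max_right _ _)
    simp only
    rw [hg, h3, Real.rpow_def_of_pos hm, ← Real.exp_add]
    congr 1; ring

/-- Case A6 mixture weight: if `c₊ > 1/2` and `c₋ > 1/2`, then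
`I₋ = ∫₀^∞ A(−y)·max(y,1)^{−2c₋} dy` and `I₊ = ∫₀^∞ A(y)·max(y,1)^{−2c₊} dy` are finite,
and for every `α > 0` the ratio `(−φ(−nα))/(φ(nα) − φ(−nα))` converges as `n → ∞` to
`p = I₋/(I₋ + I₊) ∈ (0, 1)`. -/
theorem stmt12 (atil : ℝ → ℝ) (hatil : MeasureTheory.Integrable atil)
    (cp cm : ℝ) (hcp : 1 / 2 < cp) (hcm : 1 / 2 < cm)
    (a : ℝ → ℝ)
    (ha : ∀ x : ℝ, a x = atil x + (if 1 < x then cp else if x < -1 then cm else 0) / x)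
    (A : ℝ → ℝ)
    (hA : ∀ y, A y = Real.exp (-2 * ∫ z in (0:ℝ)..y, atil z))
    (φ : ℝ → ℝ)
    (hφ : ∀ x, φ x = ∫ y in (0:ℝ)..x, Real.exp (-2 * ∫ z in (0:ℝ)..y, a z))
    (Im Ip : ℝ)
    (hIm : Im = ∫ y in Set.Ioi (0:ℝ), A (-y) * max y 1 ^ (-(2 * cm)))
    (hIp : Ip = ∫ y in Set.Ioi (0:ℝ), A y * max y 1 ^ (-(2 * cp))) :
    MeasureTheory.IntegrableOn (fun y : ℝ => A (-y) * max y 1 ^ (-(2 * cm))) (Set.Ioi 0) ∧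
    MeasureTheory.IntegrableOn (fun y : ℝ => A y * max y 1 ^ (-(2 * cp))) (Set.Ioi 0) ∧
    0 < Im / (Im + Ip) ∧ Im / (Im + Ip) < 1 ∧
    ∀ α : ℝ, 0 < α →
      Filter.Tendsto
        (fun n : ℕ => (-φ (-(n * α))) / (φ (n * α) - φ (-(n * α))))
        Filter.atTop (nhds (Im / (Im + Ip))) := by
  obtain ⟨p1, p2, p3⟩ := aux_key atil hatil cp hcp a (by
      intro z hz
      rw [ha, if_neg (show ¬ z < -1 by linarith)])
    (fun y => A y * max y 1 ^ (-(2 * cp))) (fun y => by rw [hA])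
  have hneg : ∀ (h : ℝ → ℝ) (y : ℝ), ∫ z in (0:ℝ)..(-y), h z = ∫ z in (0:ℝ)..y, -h (-z) := by
    intro h y
    rw [intervalIntegral.integral_neg, intervalIntegral.integral_comp_neg,
      intervalIntegral.integral_symm, neg_zero]
  obtain ⟨m1, m2, m3⟩ := aux_key (fun z => -atil (-z)) hatil.comp_neg.neg cm hcm
    (fun z => -a (-z)) (by
      intro z hz
      rw [ha, if_neg (show ¬ 1 < -z by linarith)]
      by_cases h : 1 < z
      · rw [if_pos (show -z < -1 by linarith), if_pos h, div_neg]; ring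
      · rw [if_neg (show ¬ -z < -1 by linarith), if_neg h]; simp)
    (fun y => A (-y) * max y 1 ^ (-(2 * cm))) (fun y => by rw [hA, hneg])
  rw [← hIp] at p2 p3
  rw [← hIm] at m2 m3
  refine ⟨m1, p1, by positivity, ?_, ?_⟩
  · rw [div_lt_one (by positivity)]; linarith
  · intro α hα
    have ht : Tendsto (fun n : ℕ => (n:ℝ) * α) atTop atTop :=
      tendsto_natCast_atTop_atTop.atTop_mul_const hα
    have hp : Tendsto (fun n : ℕ => φ (n * α)) atTop (𝓝 Ip) := by
      refine (p3.comp ht).congr fun n => ?_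
      rw [hφ]; rfl
    have hm : Tendsto (fun n : ℕ => -φ (-(n * α))) atTop (𝓝 Im) := by
      refine (m3.comp ht).congr fun n => ?_
      rw [hφ, hneg, intervalIntegral.integral_neg, neg_neg]
      simp only [Function.comp]
      exact aux_congr fun y _ => by rw [hneg a]
    have := hm.div (hp.add hm) (by positivity : Ip + Im ≠ 0)
    rw [add_comm Im Ip]
    refine this.congr fun n => ?_
    simp [sub_eq_add_neg]
end

section
/- Let T > 0, L ≥ 1, C > 0. Let x, f : [0, T] → ℝ be continuous functions and h : [0, T] → ℝ a Lebesgue integrable function such that: (i) for all 0 ≤ s ≤ t ≤ T, |x(t) − x(s)| ≤ L·|∫ₛᵗ h(z) dz| + L·|f(t) − f(s)|; and (ii) for every z ∈ [0, T] with x(z) ≠ 0, |h(z)| ≤ C / |x(z)|. Then for every Δ > 0, every δ > 0, and all s, t ∈ [0, T] with |t − s| ≤ δ, one has |x(t) − x(s)| ≤ 2LCδ/Δ + 2L·ω_f(δ) + 2Δ, where ω_f(δ) = sup{ |f(u) − f(v)| : u, v ∈ [0, T], |u − v| ≤ δ } is the modulus of continuity of f. -/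
/-- Deterministic modulus-of-continuity estimate: if `|x(t) − x(s)| ≤ L|∫ₛᵗ h| + L|f(t) − f(s)|`
and `|h(z)| ≤ C/|x(z)|` whenever `x(z) ≠ 0`, then for every `Δ > 0`, `δ > 0` and
`s, t ∈ [0, T]` with `|t − s| ≤ δ`, one has
`|x(t) − x(s)| ≤ 2LCδ/Δ + 2L·ω_f(δ) + 2Δ`. -/
theorem stmt13 (T L C : ℝ) (hT : 0 < T) (hL : 1 ≤ L) (hC : 0 < C)
    (x f h : ℝ → ℝ)
    (hx : ContinuousOn x (Set.Icc 0 T)) (hf : ContinuousOn f (Set.Icc 0 T))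
    (hh : MeasureTheory.IntegrableOn h (Set.Icc 0 T))
    (hi : ∀ s t : ℝ, 0 ≤ s → s ≤ t → t ≤ T →
      |x t - x s| ≤ L * |∫ z in s..t, h z| + L * |f t - f s|)
    (hii : ∀ z ∈ Set.Icc (0:ℝ) T, x z ≠ 0 → |h z| ≤ C / |x z|) :
    ∀ Δ : ℝ, 0 < Δ → ∀ δ : ℝ, 0 < δ →
      ∀ s ∈ Set.Icc (0:ℝ) T, ∀ t ∈ Set.Icc (0:ℝ) T, |t - s| ≤ δ →
        |x t - x s| ≤ 2 * L * C * δ / Δ +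
          2 * L * sSup {d : ℝ | ∃ u ∈ Set.Icc (0:ℝ) T, ∃ v ∈ Set.Icc (0:ℝ) T,
            |u - v| ≤ δ ∧ d = |f u - f v|} + 2 * Δ := by
  intro Δ hΔ δ hδ
  set W : Set ℝ := {d : ℝ | ∃ u ∈ Set.Icc (0:ℝ) T, ∃ v ∈ Set.Icc (0:ℝ) T,
            |u - v| ≤ δ ∧ d = |f u - f v|} with hW
  have hbdd : BddAbove W := by
    obtain ⟨M, hM⟩ := isCompact_Icc.exists_bound_of_continuousOn hf
    refine ⟨M + M, ?_⟩
    rintro d ⟨u, hu, v, hv, -, rfl⟩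
    have h1 := hM u hu
    have h2 := hM v hv
    rw [Real.norm_eq_abs] at h1 h2
    exact (abs_sub _ _).trans (add_le_add h1 h2)
  have hw : ∀ u ∈ Set.Icc (0:ℝ) T, ∀ v ∈ Set.Icc (0:ℝ) T, |u - v| ≤ δ →
      |f u - f v| ≤ sSup W := fun u hu v hv huv =>
    le_csSup hbdd ⟨u, hu, v, hv, huv, rfl⟩
  have hw0 : 0 ≤ sSup W := by
    have h0 : (0:ℝ) ∈ Set.Icc (0:ℝ) T := ⟨le_rfl, hT.le⟩
    have := hw 0 h0 0 h0 (by simpa using hδ.le)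
    simpa using this
  have hL0 : 0 < L := by linarith
  have key : ∀ a b : ℝ, 0 ≤ a → a ≤ b → b ≤ T → b - a ≤ δ →
      (∀ z, a < z → z < b → Δ ≤ |x z|) →
      |x b - x a| ≤ L * (C / Δ * δ) + L * sSup W := by
    intro a b ha hab hb hd hz
    have h1 : |∫ z in a..b, h z| ≤ C / Δ * |b - a| := by
      rw [← Real.norm_eq_abs]
      apply intervalIntegral.norm_integral_le_of_norm_le_const_ae
      filter_upwards [MeasureTheory.Measure.ae_ne MeasureTheory.volume b] with z hzb hzI
      rw [Set.uIoc_of_le hab] at hzI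
      have hx1 := hz z hzI.1 (lt_of_le_of_ne hzI.2 hzb)
      have hx0 : x z ≠ 0 := abs_pos.1 (hΔ.trans_le hx1)
      exact (hii z ⟨ha.trans hzI.1.le, hzI.2.trans hb⟩ hx0).trans
        (div_le_div_of_nonneg_left hC.le hΔ hx1)
    have hba : |b - a| ≤ δ := by rwa [abs_of_nonneg (by linarith)]
    have h2 : C / Δ * |b - a| ≤ C / Δ * δ := by gcongr
    have h3 := hw b ⟨ha.trans hab, hb⟩ a ⟨ha, hab.trans hb⟩ hba
    exact (hi a b ha hab hb).trans (add_le_add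
      (mul_le_mul_of_nonneg_left (h1.trans h2) hL0.le) (mul_le_mul_of_nonneg_left h3 hL0.le))
  have hQ : 0 ≤ L * (C / Δ * δ) := by positivity
  have hQ2 : 0 ≤ L * sSup W := mul_nonneg hL0.le hw0
  have heq : 2 * L * C * δ / Δ = 2 * (L * (C / Δ * δ)) := by ring
  have main : ∀ s t : ℝ, 0 ≤ s → s ≤ t → t ≤ T → t - s ≤ δ →
      |x t - x s| ≤ 2 * L * C * δ / Δ + 2 * L * sSup W + 2 * Δ := by
    intro s t hs hst ht hd
    rw [heq]
    have hxc : ContinuousOn (fun z => |x z|) (Set.Icc s t) :=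
      (hx.mono (Set.Icc_subset_Icc hs ht)).abs
    have hK : IsCompact (Set.Icc s t ∩ (fun z => |x z|) ⁻¹' Set.Iic Δ) :=
      isCompact_Icc.of_isClosed_subset
        (hxc.preimage_isClosed_of_isClosed isClosed_Icc isClosed_Iic) Set.inter_subset_left
    rcases Set.eq_empty_or_nonempty (Set.Icc s t ∩ (fun z => |x z|) ⁻¹' Set.Iic Δ) with he | hne
    · have := key s t hs hst ht hd (fun z h1 h2 => by
        by_contra hc
        have : z ∈ Set.Icc s t ∩ (fun z => |x z|) ⁻¹' Set.Iic Δ :=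
          ⟨⟨h1.le, h2.le⟩, (not_le.1 hc).le⟩
        rw [he] at this
        exact this)
      linarith
    · obtain ⟨p, ⟨⟨hp1, hp2⟩, hp3⟩, hpl⟩ := hK.exists_isLeast hne
      obtain ⟨q, ⟨⟨hq1, hq2⟩, hq3⟩, hqg⟩ := hK.exists_isGreatest hne
      have k1 := key s p hs hp1 (hp2.trans ht) (by linarith) (fun z h1 h2 => by
        by_contra hc
        exact absurd (hpl ⟨⟨h1.le, h2.le.trans hp2⟩, (not_le.1 hc).le⟩) (not_le.2 h2))
      have k2 := key q t (hs.trans hq1) hq2 ht (by linarith) (fun z h1 h2 => by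
        by_contra hc
        exact absurd (hqg ⟨⟨hq1.trans h1.le, h2.le⟩, (not_le.1 hc).le⟩) (not_le.2 h1))
      have hp4 : |x p| ≤ Δ := hp3
      have hq4 : |x q| ≤ Δ := hq3
      rw [abs_le] at k1 k2 hp4 hq4 ⊢
      constructor <;> linarith [k1.1, k1.2, k2.1, k2.2, hp4.1, hp4.2, hq4.1, hq4.2]
  intro s hs t ht hst
  rcases le_total s t with hle | hle
  · exact main s t hs.1 hle ht.2 ((le_abs_self _).trans hst)
  · rw [abs_sub_comm]
    rw [abs_sub_comm] at hst
    exact main t s ht.1 hle hs.2 ((le_abs_self _).trans hst)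
end

section
/- Let f, f₁, f₂, … : [0, ∞) → ℝ be continuous functions such that fₙ → f uniformly on every compact interval. Let α ∈ ℝ, and define τ = inf{ t ≥ 0 : f(t) ≥ α } and τₙ = inf{ t ≥ 0 : fₙ(t) ≥ α } (with inf ∅ = +∞). Assume τ < ∞ and that for every ε > 0 there exists t ∈ (τ, τ + ε) with f(t) > α. Then τₙ < ∞ for all sufficiently large n and τₙ → τ as n → ∞. -/
/-- Deterministic hitting-time convergence: if continuous `fₙ → f` uniformly on compacts,
`τ = inf{t ≥ 0 : f(t) ≥ α}` is finite, and `f` crosses strictly above `α` immediately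
after `τ`, then the hitting times `τₙ = inf{t ≥ 0 : fₙ(t) ≥ α}` are finite for all large
`n` and `τₙ → τ`. -/
theorem stmt17 (f : ℝ → ℝ) (F : ℕ → ℝ → ℝ)
    (hf : ContinuousOn f (Set.Ici 0))
    (hF : ∀ n, ContinuousOn (F n) (Set.Ici 0))
    (hconv : ∀ T : ℝ, 0 < T → TendstoUniformlyOn F f Filter.atTop (Set.Icc 0 T))
    (α τ : ℝ)
    (hτ : τ = sInf {t : ℝ | 0 ≤ t ∧ α ≤ f t})
    (hne : {t : ℝ | 0 ≤ t ∧ α ≤ f t}.Nonempty)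
    (hcross : ∀ ε : ℝ, 0 < ε → ∃ t : ℝ, τ < t ∧ t < τ + ε ∧ α < f t) :
    (∀ᶠ n in Filter.atTop, {t : ℝ | 0 ≤ t ∧ α ≤ F n t}.Nonempty) ∧
    Filter.Tendsto (fun n : ℕ => sInf {t : ℝ | 0 ≤ t ∧ α ≤ F n t})
      Filter.atTop (nhds τ) := by
  have hbdd : ∀ g : ℝ → ℝ, BddBelow {t : ℝ | 0 ≤ t ∧ α ≤ g t} := fun g => ⟨0, fun t ht => ht.1⟩
  have hτ0 : 0 ≤ τ := by
    rw [hτ]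
    exact Real.sInf_nonneg fun t ht => ht.1
  have hlt : ∀ t, 0 ≤ t → t < τ → f t < α := by
    intro t h0 h1
    by_contra! h
    have : τ ≤ t := by
      rw [hτ]
      exact csInf_le (hbdd f) ⟨h0, h⟩
    linarith
  have hup : ∀ ε : ℝ, 0 < ε → ∀ᶠ n in Filter.atTop,
      ∃ t, t < τ + ε ∧ 0 ≤ t ∧ α ≤ F n t := by
    intro ε hε
    obtain ⟨t, h1, h2, h3⟩ := hcross ε hε
    have h0 : 0 < t := by linarith
    have h := (hconv t h0).tendsto_at (x := t) ⟨h0.le, le_refl t⟩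
    filter_upwards [h.eventually_const_lt h3] with n hn
    exact ⟨t, h2, h0.le, hn.le⟩
  have hnon : ∀ᶠ n in Filter.atTop, {t : ℝ | 0 ≤ t ∧ α ≤ F n t}.Nonempty := by
    filter_upwards [hup 1 one_pos] with n hn
    obtain ⟨t, _, h⟩ := hn
    exact ⟨t, h⟩
  refine ⟨hnon, tendsto_order.2 ⟨fun a ha => ?_, fun a ha => ?_⟩⟩
  · by_cases hb : (a + τ) / 2 ≤ 0
    · refine Filter.Eventually.of_forall fun n => ?_
      have : 0 ≤ sInf {t : ℝ | 0 ≤ t ∧ α ≤ F n t} := Real.sInf_nonneg fun t ht => ht.1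
      linarith
    · push Not at hb
      obtain ⟨x, hx, hmax⟩ := isCompact_Icc.exists_isMaxOn (Set.nonempty_Icc.2 hb.le)
        (hf.mono (Set.Icc_subset_Ici_self : Set.Icc 0 ((a + τ) / 2) ⊆ Set.Ici 0))
      have hxα : f x < α := hlt x hx.1 (by linarith [hx.2])
      filter_upwards [hnon, Metric.tendstoUniformlyOn_iff.1 (hconv _ hb) (α - f x)
        (by linarith)] with n hn hu
      have : (a + τ) / 2 ≤ sInf {t : ℝ | 0 ≤ t ∧ α ≤ F n t} := by
        refine le_csInf hn fun t ht => ?_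
        by_contra! hc
        have h1 := hu t ⟨ht.1, hc.le⟩
        have h2 : f t ≤ f x := hmax (show t ∈ Set.Icc 0 ((a + τ) / 2) from ⟨ht.1, hc.le⟩)
        rw [Real.dist_eq] at h1
        have h3 := (abs_lt.1 h1).1
        have h4 := ht.2
        linarith
      linarith
  · filter_upwards [hup (a - τ) (by linarith)] with n hn
    obtain ⟨t, h1, h2⟩ := hn
    have := csInf_le (hbdd (F n)) h2
    linarith
end
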